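/- arXiv:0911.2296 — 2 statements merged into one kernel-verified Lean document; each statement's English description precedes it below -/
import Mathlib

section
/- Let Γ be a connected translation quiver, π: Γ̃ → Γ its generic covering and x,y vertices of Γ̃. Then: (d) if u: x = x_0 → x_1 → … → x_l = y and v: x = x_0' → x_1' → … → x_l' = y are two paths in Γ̃ from x to y and u is sectional, then x_i = x_i' for all i = 1,…,l−1; in particular, all paths from x to y in Γ̃ are sectional; (e) if u_1,…,u_r are pairwise distinct sectional paths of length n ≥ 0 from x to y in Γ̃ and λ_1,…,λ_r ∈ k are scalars, then λ_1·ū_1 + … + λ_r·ū_r lies in R^{n+1} k(Γ̃) if and only if λ_1 = … = λ_r = 0 (where ū denotes the class of the path u in the mesh category). -/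
/-! Background definitions: translation quivers, paths, hooks, sectional paths, walks,
the homotopy-like equivalence relation defining the generic covering, coverings of
translation quivers, walk lifting, and the characterization of the generic covering. -/

namespace ARDegree



/-- A translation quiver: a locally finite quiver without loops (but possibly with
multiple arrows), with distinguished projective and injective vertices, a translation `τ`
defined on non-projective vertices which is a bijection onto the non-injective vertices,
and bijections `σ` from the arrows `y → x` to the arrows `τ x → y` for `x` non-projective. -/
structure TransQuiver : Type 1 where
  V : Type
  Arr : V → V → Type
  no_loops : ∀ x : V, IsEmpty (Arr x x)
  locFinOut : ∀ x : V, Finite (Σ y : V, Arr x y)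
  locFinIn : ∀ x : V, Finite (Σ y : V, Arr y x)
  IsProj : V → Prop
  IsInj : V → Prop
  τ : ∀ x : V, ¬ IsProj x → V
  τ_not_inj : ∀ x hx, ¬ IsInj (τ x hx)
  τ_injective : ∀ x hx y hy, τ x hx = τ y hy → x = y
  τ_surjective : ∀ z : V, ¬ IsInj z → ∃ x hx, τ x hx = z
  σ : ∀ {x : V} (hx : ¬ IsProj x) {y : V}, Arr y x ≃ Arr (τ x hx) y

namespace TransQuiver

variable (Q : TransQuiver)

/-- Directed paths in a translation quiver. -/
inductive TQPath : Q.V → Q.V → Type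
  | nil (x : Q.V) : TQPath x x
  | cons {x y z : Q.V} (α : Q.Arr x y) (p : TQPath y z) : TQPath x z

variable {Q}

/-- Length of a path. -/
def TQPath.length : ∀ {x y : Q.V}, TQPath Q x y → ℕ
  | _, _, .nil _ => 0
  | _, _, .cons _ p => p.length + 1

/-- The list of vertices visited by a path (starting with its source). -/
def TQPath.vertices : ∀ {x y : Q.V}, TQPath Q x y → List Q.V
  | x, _, .nil _ => [x]
  | x, _, .cons _ p => x :: p.vertices

/-- Concatenation of paths. -/
def TQPath.append : ∀ {x y z : Q.V}, TQPath Q x y → TQPath Q y z → TQPath Q x z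
  | _, _, _, .nil _, q => q
  | _, _, _, .cons α p, q => .cons α (p.append q)

/-- `(x, z)` are the end vertices of a hook, i.e. `z` is non-projective and `x = τ z`.
A path `x → y → z` whose extremities satisfy this is a hook. -/
def HookV (x z : Q.V) : Prop := ∃ hz : ¬ Q.IsProj z, Q.τ z hz = x

/-- A path is sectional if it contains no hook. -/
def TQPath.Sectional : ∀ {x y : Q.V}, TQPath Q x y → Prop
  | _, _, .nil _ => True
  | _, _, .cons _ (.nil _) => True
  | x, _, .cons _ (.cons (y := z) β p) => ¬ HookV x z ∧ TQPath.Sectional (.cons β p)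

variable (Q)

/-- Unoriented walks in a translation quiver. -/
inductive Walk : Q.V → Q.V → Type
  | nil (x : Q.V) : Walk x x
  | fwd {x y z : Q.V} (α : Q.Arr x y) (w : Walk y z) : Walk x z
  | bwd {x y z : Q.V} (α : Q.Arr y x) (w : Walk y z) : Walk x z

/-- The equivalence relation on unoriented walks generated by cancellation of an arrow and
its formal inverse, the identification of the two branches of any mesh, the identification
of parallel arrows, and compatibility with composition; the generic covering is the covering
built from this equivalence relation as the universal covering is built from the homotopy
relation. -/
inductive WRel : ∀ {x y : Q.V}, Walk Q x y → Walk Q x y → Prop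
  | refl {x y} (w : Walk Q x y) : WRel w w
  | symm {x y} {w w' : Walk Q x y} : WRel w w' → WRel w' w
  | trans {x y} {w₁ w₂ w₃ : Walk Q x y} : WRel w₁ w₂ → WRel w₂ w₃ → WRel w₁ w₃
  | congr_fwd {x y z} (α : Q.Arr x y) {w w' : Walk Q y z} :
      WRel w w' → WRel (.fwd α w) (.fwd α w')
  | congr_bwd {x y z} (α : Q.Arr y x) {w w' : Walk Q y z} :
      WRel w w' → WRel (.bwd α w) (.bwd α w')
  | cancel_fb {x y z} (α : Q.Arr x y) (w : Walk Q x z) : WRel (.fwd α (.bwd α w)) w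
  | cancel_bf {x y z} (α : Q.Arr y x) (w : Walk Q x z) : WRel (.bwd α (.fwd α w)) w
  | parallel_fwd {x y z} (α β : Q.Arr x y) (w : Walk Q y z) : WRel (.fwd α w) (.fwd β w)
  | parallel_bwd {x y z} (α β : Q.Arr y x) (w : Walk Q y z) : WRel (.bwd α w) (.bwd β w)
  | mesh {z : Q.V} (hz : ¬ Q.IsProj z) {y y' : Q.V} (β : Q.Arr y z) (β' : Q.Arr y' z)
      {t : Q.V} (w : Walk Q z t) :
      WRel (.fwd (Q.σ hz β) (.fwd β w)) (.fwd (Q.σ hz β') (.fwd β' w))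

/-- A translation quiver is connected if any two vertices are joined by a walk. -/
def Connected : Prop := ∀ x y : Q.V, Nonempty (Walk Q x y)

variable {Q}

/-- A length function on a translation quiver. -/
def IsLengthFunction (l : Q.V → ℤ) : Prop := ∀ {x y : Q.V}, Q.Arr x y → l y = l x + 1

variable (Q) in
/-- A translation quiver is with length if parallel paths have the same length. -/
def WithLength : Prop := ∀ {x y : Q.V} (p q : TQPath Q x y), p.length = q.length

end TransQuiver

open TransQuiver

/-- A covering of translation quivers. -/
structure CovMap (Q' Q : TransQuiver) where
  onV : Q'.V → Q.V
  onA : ∀ {x y : Q'.V}, Q'.Arr x y → Q.Arr (onV x) (onV y)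
  proj_iff : ∀ x : Q'.V, Q'.IsProj x ↔ Q.IsProj (onV x)
  inj_iff : ∀ x : Q'.V, Q'.IsInj x ↔ Q.IsInj (onV x)
  comm_τ : ∀ (x : Q'.V) (hx : ¬ Q'.IsProj x) (hx' : ¬ Q.IsProj (onV x)),
      onV (Q'.τ x hx) = Q.τ (onV x) hx'
  out_bij : ∀ x : Q'.V, Function.Bijective
      (fun p : Σ y : Q'.V, Q'.Arr x y => (⟨onV p.1, onA p.2⟩ : Σ y : Q.V, Q.Arr (onV x) y))
  in_bij : ∀ x : Q'.V, Function.Bijective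
      (fun p : Σ y : Q'.V, Q'.Arr y x => (⟨onV p.1, onA p.2⟩ : Σ y : Q.V, Q.Arr y (onV x)))

namespace CovMap

variable {Q' Q : TransQuiver} (p : CovMap Q' Q)

/-- The endpoint of the (unique) lift of a walk `w` starting at a vertex `x'` over the
source of `w`. -/
noncomputable def liftEnd : ∀ {a b : Q.V}, Walk Q a b → ∀ x' : Q'.V, p.onV x' = a → Q'.V
  | _, _, .nil _, x', _ => x'
  | _, _, .fwd (y := y) α w, x', h =>
      let s := (Equiv.ofBijective _ (p.out_bij x')).symm ⟨y, h ▸ α⟩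
      liftEnd w s.1
        (congrArg Sigma.fst ((Equiv.ofBijective _ (p.out_bij x')).apply_symm_apply ⟨y, h ▸ α⟩))
  | _, _, .bwd (y := y) α w, x', h =>
      let s := (Equiv.ofBijective _ (p.in_bij x')).symm ⟨y, h ▸ α⟩
      liftEnd w s.1
        (congrArg Sigma.fst ((Equiv.ofBijective _ (p.in_bij x')).apply_symm_apply ⟨y, h ▸ α⟩))

/-- `p` is the generic covering: `Q'` is connected and two walks of `Q` with the same source
admit lifts with a common source having the same endpoint if and only if the walks are
equivalent for the defining equivalence relation of the generic covering. -/
def IsGenericCovering : Prop :=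
  Q'.Connected ∧
    ∀ (x' : Q'.V) {b : Q.V} (w w' : Walk Q (p.onV x') b),
      (p.liftEnd w x' rfl = p.liftEnd w' x' rfl) ↔ WRel Q w w'

end CovMap

end ARDegree

/-! The mesh category of a translation quiver over a field `k`: morphism spaces are
presented as the free `k`-vector space on directed paths modulo the mesh ideal, and the
powers of the ideal `R k(Γ)` generated by the classes of arrows. -/

namespace ARDegree

open TransQuiver

variable (k : Type) [Field k] (Q : TransQuiver)

/-- The free `k`-vector space on the set of paths from `x` to `y`; the morphism space
from `x` to `y` of the path category `kΓ`. -/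
abbrev PathSpace (x y : Q.V) : Type := TQPath Q x y →₀ k

/-- The generator of the mesh ideal obtained by composing the mesh sum ending at a
non-projective vertex `z` with a path `p` on the left and a path `q` on the right. -/
noncomputable def meshElt {z : Q.V} (hz : ¬ Q.IsProj z) {x y : Q.V}
    (p : TQPath Q x (Q.τ z hz)) (q : TQPath Q z y) : PathSpace k Q x y :=
  ∑ᶠ b : Σ t : Q.V, Q.Arr t z,
    Finsupp.single (p.append (.cons (Q.σ hz b.2) (.cons b.2 q))) (1 : k)

/-- The mesh ideal evaluated at `(x,y)`. -/
noncomputable def meshIdeal (x y : Q.V) : Submodule k (PathSpace k Q x y) :=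
  Submodule.span k {f | ∃ (z : Q.V) (hz : ¬ Q.IsProj z) (p : TQPath Q x (Q.τ z hz))
    (q : TQPath Q z y), f = meshElt k Q hz p q}

/-- The morphism space `k(Γ)(x,y)` of the mesh category. -/
abbrev MeshHom (x y : Q.V) : Type := PathSpace k Q x y ⧸ meshIdeal k Q x y

/-- The class in the mesh category of an element of the path category. -/
noncomputable def meshMk {x y : Q.V} (f : PathSpace k Q x y) : MeshHom k Q x y :=
  Submodule.Quotient.mk f

/-- The `n`-th power `R^n k(Γ)(x,y)` of the ideal of the mesh category generated by the
classes of the arrows: it is spanned by the classes of the paths of length at least `n`. -/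
noncomputable def RPow (n : ℕ) (x y : Q.V) : Submodule k (MeshHom k Q x y) :=
  Submodule.span k
    {f | ∃ u : TQPath Q x y, n ≤ u.length ∧ f = meshMk k Q (Finsupp.single u (1 : k))}

end ARDegree

namespace ARDegree

open TransQuiver

namespace TransQuiver

variable {Q : TransQuiver} {G : Type*} [Group G]

/-- The image of a walk in a path category. -/
def TQPath.toWalk : ∀ {x y : Q.V}, TQPath Q x y → Walk Q x y
  | _, _, .nil x => .nil x
  | _, _, .cons α p => .fwd α p.toWalk

/-- Concatenation of a walk with an arrow. -/
def Walk.snoc : ∀ {x y z : Q.V}, Walk Q x y → Q.Arr y z → Walk Q x z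
  | _, _, _, .nil _, β => .fwd β (.nil _)
  | _, _, _, .fwd α w, β => .fwd α (w.snoc β)
  | _, _, _, .bwd α w, β => .bwd α (w.snoc β)

/-- The value of a walk under a labelling of the arrows by elements of a group. -/
def Walk.val (f : Q.V → Q.V → G) : ∀ {x y : Q.V}, Walk Q x y → G
  | _, _, .nil _ => 1
  | x, _, .fwd (y := y) _ w => f x y * w.val f
  | x, _, .bwd (y := y) _ w => (f y x)⁻¹ * w.val f

theorem Walk.val_snoc (f : Q.V → Q.V → G) {x y z : Q.V} (w : Walk Q x y) (β : Q.Arr y z) :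
    (w.snoc β).val f = w.val f * f y z := by
  induction w with
  | nil x => simp [Walk.snoc, Walk.val]
  | fwd α w ih => simp [Walk.snoc, Walk.val, ih, mul_assoc]
  | bwd α w ih => simp [Walk.snoc, Walk.val, ih, mul_assoc]

/-- A labelling of the arrows by elements of a group is compatible with the meshes if all the
paths through a given mesh have the same value. -/
def MeshCompatible (f : Q.V → Q.V → G) : Prop :=
  ∀ (z : Q.V) (hz : ¬ Q.IsProj z) (y y' : Q.V), Nonempty (Q.Arr y z) → Nonempty (Q.Arr y' z) →
    f (Q.τ z hz) y * f y z = f (Q.τ z hz) y' * f y' z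

end TransQuiver

namespace CovMap

variable {Q' Q : TransQuiver} (p : CovMap Q' Q) {G : Type*} [Group G]

/-- The image of a walk under a covering. -/
def mapWalk : ∀ {x y : Q'.V}, Walk Q' x y → Walk Q (p.onV x) (p.onV y)
  | _, _, .nil x => .nil (p.onV x)
  | _, _, .fwd α w => .fwd (p.onA α) (mapWalk w)
  | _, _, .bwd α w => .bwd (p.onA α) (mapWalk w)

/-- The value, under a labelling of the arrows of the covering, of the lift of a walk starting
at a given vertex. -/
noncomputable def liftVal (f : Q'.V → Q'.V → G) :
    ∀ {a b : Q.V}, Walk Q a b → ∀ x' : Q'.V, p.onV x' = a → G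
  | _, _, .nil _, _, _ => 1
  | _, _, .fwd (y := y) α w, x', h =>
      let s := (Equiv.ofBijective _ (p.out_bij x')).symm ⟨y, h ▸ α⟩
      f x' s.1 * liftVal f w s.1
        (congrArg Sigma.fst ((Equiv.ofBijective _ (p.out_bij x')).apply_symm_apply ⟨y, h ▸ α⟩))
  | _, _, .bwd (y := y) α w, x', h =>
      let s := (Equiv.ofBijective _ (p.in_bij x')).symm ⟨y, h ▸ α⟩
      (f s.1 x')⁻¹ * liftVal f w s.1
        (congrArg Sigma.fst ((Equiv.ofBijective _ (p.in_bij x')).apply_symm_apply ⟨y, h ▸ α⟩))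

variable (f : Q'.V → Q'.V → G)

theorem lift_fwd {x y : Q'.V} (α : Q'.Arr x y) {b : Q.V} (w : Walk Q (p.onV y) b) :
    p.liftEnd (.fwd (p.onA α) w) x rfl = p.liftEnd w y rfl ∧
      p.liftVal f (.fwd (p.onA α) w) x rfl = f x y * p.liftVal f w y rfl := by
  have aux : ∀ s : Σ y : Q'.V, Q'.Arr x y, s = ⟨y, α⟩ → ∀ h : p.onV s.1 = p.onV y,
      p.liftEnd w s.1 h = p.liftEnd w y rfl ∧
        f x s.1 * p.liftVal f w s.1 h = f x y * p.liftVal f w y rfl := by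
    rintro _ rfl _
    exact ⟨rfl, rfl⟩
  exact aux _ ((Equiv.ofBijective _ (p.out_bij x)).symm_apply_apply ⟨y, α⟩) _

theorem lift_bwd {x y : Q'.V} (α : Q'.Arr y x) {b : Q.V} (w : Walk Q (p.onV y) b) :
    p.liftEnd (.bwd (p.onA α) w) x rfl = p.liftEnd w y rfl ∧
      p.liftVal f (.bwd (p.onA α) w) x rfl = (f y x)⁻¹ * p.liftVal f w y rfl := by
  have aux : ∀ s : Σ y : Q'.V, Q'.Arr y x, s = ⟨y, α⟩ → ∀ h : p.onV s.1 = p.onV y,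
      p.liftEnd w s.1 h = p.liftEnd w y rfl ∧
        (f s.1 x)⁻¹ * p.liftVal f w s.1 h = (f y x)⁻¹ * p.liftVal f w y rfl := by
    rintro _ rfl _
    exact ⟨rfl, rfl⟩
  exact aux _ ((Equiv.ofBijective _ (p.in_bij x)).symm_apply_apply ⟨y, α⟩) _

theorem lift_mapWalk {x y : Q'.V} (w : Walk Q' x y) :
    p.liftEnd (p.mapWalk w) x rfl = y ∧ p.liftVal f (p.mapWalk w) x rfl = w.val f := by
  induction w with
  | nil x => exact ⟨rfl, rfl⟩
  | fwd α w ih =>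
    exact ⟨(p.lift_fwd f α _).1.trans ih.1,
      (p.lift_fwd f α _).2.trans (congrArg (f _ _ * ·) ih.2)⟩
  | bwd α w ih =>
    exact ⟨(p.lift_bwd f α _).1.trans ih.1,
      (p.lift_bwd f α _).2.trans (congrArg ((f _ _)⁻¹ * ·) ih.2)⟩

/-- Lifting an arrow with prescribed source. -/
theorem exists_lift_out {a y : Q.V} (α : Q.Arr a y) (x' : Q'.V) (h : p.onV x' = a) :
    ∃ (y' : Q'.V) (hy : p.onV y' = y) (_ : Q'.Arr x' y'),
      (∀ {b : Q.V} (w : Walk Q y b), p.liftEnd (.fwd α w) x' h = p.liftEnd w y' hy ∧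
        p.liftVal f (.fwd α w) x' h = f x' y' * p.liftVal f w y' hy) ∧
      (∀ {b : Q.V} (w : Walk Q a b),
        p.liftVal f (.bwd α w) y' hy = (f x' y')⁻¹ * p.liftVal f w x' h) := by
  subst h
  obtain ⟨⟨y', α'⟩, hs⟩ := (p.out_bij x').2 ⟨y, α⟩
  cases hs
  exact ⟨y', rfl, α', fun w => p.lift_fwd f α' w, fun w => (p.lift_bwd f α' w).2⟩

/-- Lifting an arrow with prescribed target. -/
theorem exists_lift_in {a y : Q.V} (α : Q.Arr y a) (x' : Q'.V) (h : p.onV x' = a) :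
    ∃ (y' : Q'.V) (hy : p.onV y' = y) (_ : Q'.Arr y' x'),
      (∀ {b : Q.V} (w : Walk Q y b), p.liftEnd (.bwd α w) x' h = p.liftEnd w y' hy ∧
        p.liftVal f (.bwd α w) x' h = (f y' x')⁻¹ * p.liftVal f w y' hy) ∧
      (∀ {b : Q.V} (w : Walk Q a b),
        p.liftVal f (.fwd α w) y' hy = f y' x' * p.liftVal f w x' h) := by
  subst h
  obtain ⟨⟨y', α'⟩, hs⟩ := (p.in_bij x').2 ⟨y, α⟩
  cases hs
  exact ⟨y', rfl, α', fun w => p.lift_bwd f α' w, fun w => (p.lift_fwd f α' w).2⟩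

variable {p f}

theorem IsGenericCovering.liftEnd_eq (hp : p.IsGenericCovering) {a b : Q.V} {w w' : Walk Q a b}
    (h : WRel Q w w') (x' : Q'.V) (hx : p.onV x' = a) :
    p.liftEnd w x' hx = p.liftEnd w' x' hx := by
  subst hx
  exact (hp.2 x' w w').2 h

/-- In a generic covering, parallel arrows lift to parallel arrows. -/
theorem IsGenericCovering.liftEnd_arrow (hp : p.IsGenericCovering) {x y : Q'.V}
    (α : Q'.Arr x y) {c : Q.V} (hy : p.onV y = c) (β : Q.Arr (p.onV x) c) :
    p.liftEnd (.fwd β (.nil c)) x rfl = y := by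
  subst hy
  rw [hp.liftEnd_eq (WRel.parallel_fwd β (p.onA α) _)]
  exact (p.lift_fwd (fun _ _ => (1 : ℤˣ)) α _).1

theorem IsGenericCovering.liftVal_eq (hp : p.IsGenericCovering) (hf : MeshCompatible f)
    {a b : Q.V} {w w' : Walk Q a b} (h : WRel Q w w') :
    ∀ (x' : Q'.V) (hx : p.onV x' = a), p.liftVal f w x' hx = p.liftVal f w' x' hx := by
  induction h with
  | refl w => exact fun _ _ => rfl
  | symm _ ih => exact fun x' hx => (ih x' hx).symm
  | trans _ _ ih₁ ih₂ => exact fun x' hx => (ih₁ x' hx).trans (ih₂ x' hx)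
  | congr_fwd α _ ih =>
    intro x' hx
    obtain ⟨y', hy, -, h, -⟩ := p.exists_lift_out f α x' hx
    rw [(h _).2, (h _).2, ih]
  | congr_bwd α _ ih =>
    intro x' hx
    obtain ⟨y', hy, -, h, -⟩ := p.exists_lift_in f α x' hx
    rw [(h _).2, (h _).2, ih]
  | cancel_fb α w =>
    intro x' hx
    obtain ⟨y', hy, -, h, h'⟩ := p.exists_lift_out f α x' hx
    rw [(h _).2, h', mul_inv_cancel_left]
  | cancel_bf α w =>
    intro x' hx
    obtain ⟨y', hy, -, h, h'⟩ := p.exists_lift_in f α x' hx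
    rw [(h _).2, h', inv_mul_cancel_left]
  | parallel_fwd α β w =>
    intro x' hx
    obtain ⟨y₁, hy₁, α₁, h₁, -⟩ := p.exists_lift_out f α x' hx
    obtain ⟨y₂, hy₂, α₂, h₂, -⟩ := p.exists_lift_out f β x' hx
    have : y₁ = y₂ := by
      have h := hp.liftEnd_eq (WRel.parallel_fwd α β (.nil _)) x' hx
      rw [(h₁ _).1, (h₂ _).1] at h
      exact h
    subst this
    rw [(h₁ _).2, (h₂ _).2]
  | parallel_bwd α β w =>
    intro x' hx
    obtain ⟨y₁, hy₁, α₁, h₁, -⟩ := p.exists_lift_in f α x' hx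
    obtain ⟨y₂, hy₂, α₂, h₂, -⟩ := p.exists_lift_in f β x' hx
    have : y₁ = y₂ := by
      have h := hp.liftEnd_eq (WRel.parallel_bwd α β (.nil _)) x' hx
      rw [(h₁ _).1, (h₂ _).1] at h
      exact h
    subst this
    rw [(h₁ _).2, (h₂ _).2]
  | @mesh z hz y₁ y₂ β₁ β₂ b w =>
    intro x' hx
    have hinj : ¬ Q'.IsInj x' := by
      rw [p.inj_iff, hx]
      exact Q.τ_not_inj z hz
    obtain ⟨z', hz', rfl⟩ := Q'.τ_surjective x' hinj
    have hz'' : ¬ Q.IsProj (p.onV z') := by rwa [← p.proj_iff]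
    have hzz : p.onV z' = z := Q.τ_injective _ hz'' _ hz (by rw [← p.comm_τ z' hz', hx])
    have key : ∀ {y : Q.V} (β : Q.Arr y z), ∃ y' : Q'.V, Nonempty (Q'.Arr y' z') ∧
        p.liftVal f (.fwd (Q.σ hz β) (.fwd β w)) (Q'.τ z' hz') hx =
          f (Q'.τ z' hz') y' * f y' z' * p.liftVal f w z' hzz := by
      intro y β
      obtain ⟨y', rfl, α', h, -⟩ := p.exists_lift_out f (Q.σ hz β) _ hx
      obtain ⟨t, ht, γ, h', -⟩ := p.exists_lift_out f β y' rfl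
      have hend := hp.liftEnd_arrow ((Q'.σ hz').symm α') hzz β
      rw [(h' _).1] at hend
      change t = z' at hend
      subst hend
      exact ⟨y', ⟨γ⟩, by rw [(h _).2, (h' _).2, mul_assoc]⟩
    obtain ⟨y₁', n₁, e₁⟩ := key β₁
    obtain ⟨y₂', n₂, e₂⟩ := key β₂
    rw [e₁, e₂, hf z' hz' y₁' y₂' n₁ n₂]

/-- The value of a walk in a generic covering under a labelling compatible with the meshes depends
only on the end vertices. -/
theorem IsGenericCovering.val_eq (hp : p.IsGenericCovering) (hf : MeshCompatible f)
    {x y : Q'.V} (w w' : Walk Q' x y) : w.val f = w'.val f := by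
  rw [← (p.lift_mapWalk f w).2, ← (p.lift_mapWalk f w').2]
  refine hp.liftVal_eq hf ((hp.2 x _ _).1 ?_) x rfl
  rw [(p.lift_mapWalk f w).1, (p.lift_mapWalk f w').1]

/-- A generic covering admits a length function. -/
theorem IsGenericCovering.exists_isLengthFunction (hp : p.IsGenericCovering) (x₀ : Q'.V) :
    ∃ l : Q'.V → ℤ, IsLengthFunction l := by
  let f : Q'.V → Q'.V → Multiplicative ℤ := fun _ _ => Multiplicative.ofAdd 1
  have hf : MeshCompatible f := fun _ _ _ _ _ _ => rfl
  let w : ∀ y, Walk Q' x₀ y := fun y => (hp.1 x₀ y).some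
  refine ⟨fun y => ((w y).val f).toAdd, fun {x y} α => ?_⟩
  change ((w y).val f).toAdd = _
  rw [hp.val_eq hf (w y) ((w x).snoc α), Walk.val_snoc]
  rfl

end CovMap

namespace TransQuiver

variable {Q : TransQuiver}

/-- The partial operation `(x → z) ↦ (τ z → x)` induced by `σ` on pairs of adjacent vertices. -/
def ArrowShift (a b : Q.V × Q.V) : Prop :=
  Nonempty (Q.Arr a.1 a.2) ∧ ∃ hz : ¬ Q.IsProj a.2, b = (Q.τ a.2 hz, a.1)

theorem ArrowShift.rightUnique : Relator.RightUnique (ArrowShift (Q := Q)) := by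
  rintro a b c ⟨-, _, rfl⟩ ⟨-, _, rfl⟩
  rfl

theorem ArrowShift.leftUnique : Relator.LeftUnique (ArrowShift (Q := Q)) := by
  rintro a b c ⟨-, h, rfl⟩ ⟨-, h', e⟩
  rw [Prod.mk.injEq] at e
  exact Prod.ext e.2 (Q.τ_injective _ _ _ _ e.1)

theorem ArrowShift.reflTransGen_of_eqvGen {a b : Q.V × Q.V}
    (h : Relation.EqvGen ArrowShift a b) :
    Relation.ReflTransGen ArrowShift a b ∨ Relation.ReflTransGen ArrowShift b a := by
  induction h with
  | rel a b h => exact .inl (.single h)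
  | refl a => exact .inl .refl
  | symm a b _ ih => exact ih.symm
  | trans a b c _ _ ih₁ ih₂ =>
    rcases ih₁ with h₁ | h₁ <;> rcases ih₂ with h₂ | h₂
    · exact .inl (h₁.trans h₂)
    · rw [← Relation.reflTransGen_swap] at h₁ h₂
      have h := Relation.ReflTransGen.total_of_right_unique
        (r := Function.swap (ArrowShift (Q := Q)))
        (fun _ _ _ h h' => ArrowShift.leftUnique h h') h₁ h₂
      exact h.symm.imp Relation.reflTransGen_swap.1 Relation.reflTransGen_swap.1
    · exact Relation.ReflTransGen.total_of_right_unique ArrowShift.rightUnique h₁ h₂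
    · exact .inr (h₂.trans h₁)

/-- The orbits of pairs of vertices under `ArrowShift`. -/
abbrev ArrowOrbit (Q : TransQuiver) : Type := Quot (ArrowShift (Q := Q))

variable {l : Q.V → ℤ}

theorem ArrowShift.length_eq (hl : IsLengthFunction l) {a b : Q.V × Q.V} (h : ArrowShift a b) :
    l a.1 = l b.1 + 1 := by
  obtain ⟨⟨α⟩, hz, rfl⟩ := h
  exact hl (Q.σ hz α)

theorem ArrowShift.length_le (hl : IsLengthFunction l) {a b : Q.V × Q.V}
    (h : Relation.ReflTransGen ArrowShift a b) : l b.1 ≤ l a.1 := by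
  induction h with
  | refl => exact le_rfl
  | tail _ h ih =>
    have := h.length_eq hl
    omega

theorem ArrowShift.eq_of_reflTransGen (hl : IsLengthFunction l) {a b : Q.V × Q.V}
    (h : Relation.ReflTransGen ArrowShift a b) (hab : l a.1 = l b.1) : a = b := by
  rcases h.cases_head with h | ⟨c, hac, hcb⟩
  · exact h
  · have := hac.length_eq hl
    have := ArrowShift.length_le hl hcb
    omega

theorem ArrowOrbit.eq_of_length_eq (hl : IsLengthFunction l) {a b : Q.V × Q.V}
    (h : (Quot.mk _ a : ArrowOrbit Q) = Quot.mk _ b) (hab : l a.1 = l b.1) : a = b := by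
  rcases ArrowShift.reflTransGen_of_eqvGen (Quot.eqvGen_exact h) with h | h
  · exact ArrowShift.eq_of_reflTransGen hl h hab
  · exact (ArrowShift.eq_of_reflTransGen hl h hab.symm).symm

theorem ArrowOrbit.arrowShift_of_length_eq (hl : IsLengthFunction l) {a b : Q.V × Q.V}
    (h : (Quot.mk _ a : ArrowOrbit Q) = Quot.mk _ b) (hab : l a.1 = l b.1 + 1) :
    ArrowShift a b := by
  rcases ArrowShift.reflTransGen_of_eqvGen (Quot.eqvGen_exact h) with h | h
  · rcases h.cases_head with rfl | ⟨c, hac, hcb⟩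
    · omega
    · have := hac.length_eq hl
      rwa [← ArrowShift.eq_of_reflTransGen hl hcb (by omega)]
  · have := ArrowShift.length_le hl h
    omega

/-- Two consecutive arrows form a hook if and only if they have the same orbit. -/
theorem ArrowOrbit.eq_iff_hookV (hl : IsLengthFunction l) {x y z : Q.V} (α : Q.Arr x y)
    (β : Q.Arr y z) :
    (Quot.mk _ (x, y) : ArrowOrbit Q) = Quot.mk _ (y, z) ↔ HookV x z := by
  constructor
  · intro h
    obtain ⟨-, hz, e⟩ := ArrowOrbit.arrowShift_of_length_eq hl h.symm (hl α)
    exact ⟨hz, congrArg Prod.fst e.symm⟩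
  · rintro ⟨hz, rfl⟩
    exact (Quot.sound ⟨⟨β⟩, hz, rfl⟩).symm

/-- The signed orbit of a pair of vertices, the sign being the parity of the length. -/
noncomputable def arrowLetter (l : Q.V → ℤ) (x y : Q.V) : ArrowOrbit Q × Bool :=
  (Quot.mk _ (x, y), decide (Even (l x)))

/-- The word of signed orbits of the arrows of a path. -/
noncomputable def TQPath.word (l : Q.V → ℤ) :
    ∀ {x y : Q.V}, TQPath Q x y → List (ArrowOrbit Q × Bool)
  | _, _, .nil _ => []
  | x, _, .cons (y := y) _ p => arrowLetter l x y :: p.word l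

theorem TQPath.length_word (l : Q.V → ℤ) {x y : Q.V} (p : TQPath Q x y) :
    (p.word l).length = p.length := by
  induction p with
  | nil x => rfl
  | cons α p ih => simp [TQPath.word, TQPath.length, ih]

theorem meshCompatible_arrowLetter (hl : IsLengthFunction l) :
    MeshCompatible (fun x y : Q.V => FreeGroup.mk [arrowLetter l x y]) := by
  have key : ∀ (z : Q.V) (hz : ¬ Q.IsProj z) (y : Q.V), Nonempty (Q.Arr y z) →
      FreeGroup.mk [arrowLetter l (Q.τ z hz) y] * FreeGroup.mk [arrowLetter l y z] = 1 := by
    rintro z hz y ⟨β⟩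
    have h : l y = l (Q.τ z hz) + 1 := hl (Q.σ hz β)
    have h₁ : arrowLetter l (Q.τ z hz) y =
        ((arrowLetter l y z).1, !(arrowLetter l y z).2) := by
      refine Prod.ext (Quot.sound ⟨⟨β⟩, hz, rfl⟩).symm ?_
      simp [arrowLetter, h, ← Int.not_even_iff_odd]
    rw [h₁, FreeGroup.mul_mk, FreeGroup.one_eq_mk]
    exact Quot.sound FreeGroup.Red.Step.cons_not_rev
  intro z hz y y' hy hy'
  exact (key z hz y hy).trans (key z hz y' hy').symm

theorem TQPath.val_toWalk (l : Q.V → ℤ) {x y : Q.V} (p : TQPath Q x y) :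
    p.toWalk.val (fun x y : Q.V => FreeGroup.mk [arrowLetter l x y]) =
      FreeGroup.mk (p.word l) := by
  induction p with
  | nil x => rfl
  | cons α p ih =>
    simp only [TQPath.toWalk, Walk.val, ih, TQPath.word]
    rw [FreeGroup.mul_mk]
    rfl

/-- A path is sectional if and only if its word of signed orbits is reduced. -/
theorem TQPath.sectional_iff_isReduced (hl : IsLengthFunction l) {x y : Q.V}
    (p : TQPath Q x y) : p.Sectional ↔ FreeGroup.IsReduced (p.word l) := by
  induction p with
  | nil x => simp [TQPath.Sectional, TQPath.word]
  | @cons x y t α p ih =>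
    cases p with
    | nil => simp [TQPath.Sectional, TQPath.word]
    | @cons _ z _ β p =>
      have h := hl α
      have h₂ : (arrowLetter l x y).2 ≠ (arrowLetter l y z).2 := by
        simp [arrowLetter, h, ← Int.not_even_iff_odd]
      have h₁ := ArrowOrbit.eq_iff_hookV hl α β
      rw [TQPath.Sectional, ih]
      simp only [TQPath.word]
      rw [FreeGroup.isReduced_cons_cons, ← h₁]
      exact and_congr_left' ⟨fun h e => absurd e h, fun h e => h₂ (h e)⟩

theorem TQPath.vertices_eq_of_word_eq (hl : IsLengthFunction l) {x y : Q.V}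
    (u v : TQPath Q x y) (h : u.word l = v.word l) : u.vertices = v.vertices := by
  induction u with
  | nil x =>
    cases v with
    | nil => rfl
    | cons β q => simp [TQPath.word] at h
  | cons α p ih =>
    cases v with
    | nil => simp [TQPath.word] at h
    | cons β q =>
      simp only [TQPath.word, List.cons.injEq] at h
      have e := ArrowOrbit.eq_of_length_eq hl (congrArg Prod.fst h.1) rfl
      cases e
      rw [TQPath.vertices, TQPath.vertices, ih q h.2]

theorem TQPath.not_sectional_append_hook {x a y z t : Q.V} (p : TQPath Q x a) (α : Q.Arr a y)
    (β : Q.Arr y z) (q : TQPath Q z t) (h : HookV a z) :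
    ¬ (p.append (.cons α (.cons β q))).Sectional := by
  induction p with
  | nil x => exact fun hs => hs.1 h
  | cons γ p ih =>
    intro hs
    refine ih α h ?_
    cases p with
    | nil => exact hs.2
    | cons δ p => exact hs.2

theorem TQPath.length_eq (hl : IsLengthFunction l) {x y : Q.V} (u : TQPath Q x y) :
    (u.length : ℤ) = l y - l x := by
  induction u with
  | nil x => simp [TQPath.length]
  | cons α p ih =>
    have := hl α
    simp only [TQPath.length]
    push_cast
    omega

end TransQuiver

/-- Parallel paths in a generic covering visit the same vertices as soon as one of them is
sectional. -/
theorem CovMap.IsGenericCovering.vertices_eq {Q Q' : TransQuiver} {p : CovMap Q' Q}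
    (hp : p.IsGenericCovering) {x y : Q'.V} (u v : TQPath Q' x y) (hu : u.Sectional) :
    u.vertices = v.vertices ∧ v.Sectional := by
  obtain ⟨l, hl⟩ := hp.exists_isLengthFunction x
  have hlen : u.length = v.length := by
    have h₁ := u.length_eq hl
    have h₂ := v.length_eq hl
    omega
  have hval := hp.val_eq (meshCompatible_arrowLetter hl) u.toWalk v.toWalk
  rw [TQPath.val_toWalk, TQPath.val_toWalk] at hval
  obtain ⟨w, h₁, h₂⟩ := FreeGroup.Red.exact.1 hval
  have hred := (u.sectional_iff_isReduced hl).1 hu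
  rw [hred.red_iff_eq] at h₁
  subst h₁
  have hw : u.word l = v.word l :=
    h₂.sublist.eq_of_length (by rw [TQPath.length_word, TQPath.length_word, hlen])
  exact ⟨u.vertices_eq_of_word_eq hl v hw, (v.sectional_iff_isReduced hl).2 (hw ▸ hred)⟩

theorem meshIdeal_eq_bot (k : Type) [Field k] {Q : TransQuiver} {x y : Q.V}
    (h : ∀ u : TQPath Q x y, u.Sectional) : meshIdeal k Q x y = ⊥ := by
  rw [meshIdeal, Submodule.span_eq_bot]
  rintro _ ⟨z, hz, p, q, rfl⟩
  have : IsEmpty (Σ t : Q.V, Q.Arr t z) :=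
    ⟨fun b => p.not_sectional_append_hook (Q.σ hz b.2) b.2 q ⟨hz, rfl⟩ (h _)⟩
  rw [meshElt, finsum_of_isEmpty]

/-- **Proposition 1.2 (d)-(e).** Let `π : Γ̃ → Γ` be the generic covering of a connected
translation quiver `Γ`, and `x, y` vertices of `Γ̃`. (d) If `u` and `v` are parallel paths
from `x` to `y` and `u` is sectional, then `u` and `v` visit the same vertices (in
particular every path from `x` to `y` is sectional). (e) If `u_1, …, u_r` are pairwise
distinct sectional paths of length `n` from `x` to `y` and `λ_1, …, λ_r` are scalars, then
`Σ λ_i • ū_i ∈ R^{n+1} k(Γ̃)` iff all `λ_i = 0`. -/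
theorem generic_covering_sectional_paths
    (k : Type) [Field k] (Q Q' : TransQuiver) (hQ : Q.Connected) (p : CovMap Q' Q)
    (hp : p.IsGenericCovering) (x y : Q'.V) :
    (∀ u v : TQPath Q' x y, u.Sectional → u.length = v.length →
      u.vertices = v.vertices ∧ v.Sectional) ∧
    (∀ (r : ℕ) (u : Fin r → TQPath Q' x y) (n : ℕ) (lam : Fin r → k),
      (∀ i j : Fin r, i ≠ j → u i ≠ u j) → (∀ i, (u i).Sectional) →
      (∀ i, (u i).length = n) →
      ((∑ i : Fin r, lam i • meshMk k Q' (Finsupp.single (u i) (1 : k)))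
          ∈ RPow k Q' (n + 1) x y ↔ ∀ i, lam i = 0)) := by
  refine ⟨fun u v hu _ => hp.vertices_eq u v hu, fun r u n lam hne hsec hlen => ⟨?_, ?_⟩⟩
  · intro hmem i
    obtain ⟨l, hl⟩ := hp.exists_isLengthFunction x
    have hR : RPow k Q' (n + 1) x y = ⊥ := by
      rw [RPow, Submodule.span_eq_bot]
      rintro _ ⟨v, hv, -⟩
      have h₁ := v.length_eq hl
      have h₂ := (u i).length_eq hl
      have h₃ := hlen i
      omega
    have hbot := meshIdeal_eq_bot k fun v => (hp.vertices_eq (u i) v (hsec i)).2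
    have hsum : (∑ j : Fin r, lam j • Finsupp.single (u j) (1 : k)) ∈ meshIdeal k Q' x y := by
      rw [← Submodule.Quotient.mk_eq_zero, ← Submodule.mkQ_apply, map_sum]
      simp only [map_smul]
      rw [hR, Submodule.mem_bot] at hmem
      exact hmem
    rw [hbot, Submodule.mem_bot] at hsum
    have hinj : Function.Injective u := fun a b hab => by
      by_contra h
      exact hne a b h hab
    have hi := DFunLike.congr_fun hsum (u i)
    classical
    rw [Finsupp.finsetSum_apply] at hi
    simpa [Finsupp.single_apply, hinj.eq_iff] using hi
  · intro h
    simp [h]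

end ARDegree
end

section
/- Let A be a finite dimensional algebra over an algebraically closed field k, f: X → Y an irreducible morphism with X indecomposable, Γ the Auslander-Reiten component containing X and n a natural number. Then: (a) if d_l(f) = n, there exist a module Z in Γ and h ∈ rad^n(Z,X) ∖ rad^{n+1}(Z,X) such that f∘h = 0; (b) if d_r(f) = n, there exist a module Z in Γ and h ∈ rad^n(Y,Z) ∖ rad^{n+1}(Y,Z) such that h∘f = 0. -/
/-! Background definitions: the category `mod A` of finite dimensional modules over a
finite dimensional algebra `A` over an algebraically closed field `k`, its radical and
radical powers, irreducible morphisms, left and right degrees of irreducible morphisms,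
(minimal) almost split morphisms and almost split sequences, and the Auslander-Reiten
components (as the "same component" relation). -/

open CategoryTheory



namespace ARDegree

variable (k : Type) [Field k] (A : Type) [Ring A] [Algebra k A]

/-- The (big) category of `A`-modules. -/
abbrev Mod := ModuleCat.{0} A

variable {A}

/-- `M` is an object of `mod A`, i.e. a finite dimensional (equivalently, finitely
generated) `A`-module. -/
def FD (M : Mod A) : Prop := Module.Finite A M

/-- `f` belongs to the (Jacobson) radical of the module category. -/
def IsRadMor {X Y : Mod A} (f : X ⟶ Y) : Prop := ∀ g : Y ⟶ X, IsIso (𝟙 X - f ≫ g)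

/-- `f` is a composite of `n` radical morphisms between finite dimensional modules. -/
inductive RadComp : ℕ → ∀ (X Y : Mod A), (X ⟶ Y) → Prop
  | zero {X Y : Mod A} (f : X ⟶ Y) : RadComp 0 X Y f
  | succ {X Y Z : Mod A} {n : ℕ} {f : X ⟶ Y} {g : Y ⟶ Z} (hY : FD Y) (hf : IsRadMor f)
      (hg : RadComp n Y Z g) : RadComp (n + 1) X Z (f ≫ g)

/-- The `n`-th power `rad^n(X,Y)` of the radical of `mod A`; by convention
`rad^0(X,Y) = Hom(X,Y)`. -/
def radPow (n : ℕ) (X Y : Mod A) : Submodule k (X ⟶ Y) :=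
  Submodule.span k {f : X ⟶ Y | RadComp n X Y f}

/-- `rad^∞(X,Y)`, the intersection of all powers of the radical. -/
def radInf (X Y : Mod A) : Submodule k (X ⟶ Y) := ⨅ n : ℕ, radPow k n X Y

/-- A morphism of `mod A` is irreducible if it is neither a split monomorphism nor a split
epimorphism and, in any factorization through a finite dimensional module, the first factor
is a split monomorphism or the second factor is a split epimorphism. -/
def Irred {X Y : Mod A} (f : X ⟶ Y) : Prop :=
  ¬ IsSplitMono f ∧ ¬ IsSplitEpi f ∧
    ∀ (Z : Mod A), FD Z → ∀ (g : X ⟶ Z) (h : Z ⟶ Y), g ≫ h = f → IsSplitMono g ∨ IsSplitEpi h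

/-- `X` is an indecomposable module. -/
def Indec (X : Mod A) : Prop :=
  ¬ Limits.IsZero X ∧ ∀ e : X ⟶ X, e ≫ e = e → e = 0 ∨ e = 𝟙 X

/-- `m` is a bound witnessing finiteness of the left degree of `f`, i.e. `m ≥ 1` and there are
a module `Z` in `mod A` and `g ∈ rad^m(Z,X) ∖ rad^{m+1}(Z,X)` with `f ∘ g ∈ rad^{m+2}(Z,Y)`. -/
def LeftDegBound {X Y : Mod A} (f : X ⟶ Y) (m : ℕ) : Prop :=
  1 ≤ m ∧ ∃ (Z : Mod A), FD Z ∧ ∃ g : Z ⟶ X,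
    g ∈ radPow k m Z X ∧ g ∉ radPow k (m + 1) Z X ∧ g ≫ f ∈ radPow k (m + 2) Z Y

/-- The left degree `d_l(f) ∈ ℕ∞` of a morphism. -/
noncomputable def leftDeg {X Y : Mod A} (f : X ⟶ Y) : ℕ∞ :=
  sInf {n : ℕ∞ | ∃ m : ℕ, n = (m : ℕ∞) ∧ LeftDegBound k f m}

/-- `m` is a bound witnessing finiteness of the right degree of `f`. -/
def RightDegBound {X Y : Mod A} (f : X ⟶ Y) (m : ℕ) : Prop :=
  1 ≤ m ∧ ∃ (Z : Mod A), FD Z ∧ ∃ g : Y ⟶ Z,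
    g ∈ radPow k m Y Z ∧ g ∉ radPow k (m + 1) Y Z ∧ f ≫ g ∈ radPow k (m + 2) X Z

/-- The right degree `d_r(f) ∈ ℕ∞` of a morphism. -/
noncomputable def rightDeg {X Y : Mod A} (f : X ⟶ Y) : ℕ∞ :=
  sInf {n : ℕ∞ | ∃ m : ℕ, n = (m : ℕ∞) ∧ RightDegBound k f m}

/-- `f : X ⟶ Y` is a left almost split morphism in `mod A`. -/
def IsLeftAS {X Y : Mod A} (f : X ⟶ Y) : Prop :=
  ¬ IsSplitMono f ∧
    ∀ (Z : Mod A), FD Z → ∀ g : X ⟶ Z, ¬ IsSplitMono g → ∃ h : Y ⟶ Z, f ≫ h = g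

/-- `f : X ⟶ Y` is a minimal left almost split morphism in `mod A`. -/
def IsMinLeftAS {X Y : Mod A} (f : X ⟶ Y) : Prop :=
  IsLeftAS f ∧ ∀ h : Y ⟶ Y, f ≫ h = f → IsIso h

/-- `f : X ⟶ Y` is a right almost split morphism in `mod A`. -/
def IsRightAS {X Y : Mod A} (f : X ⟶ Y) : Prop :=
  ¬ IsSplitEpi f ∧
    ∀ (Z : Mod A), FD Z → ∀ g : Z ⟶ Y, ¬ IsSplitEpi g → ∃ h : Z ⟶ X, h ≫ f = g

/-- `f : X ⟶ Y` is a minimal right almost split morphism in `mod A`. -/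
def IsMinRightAS {X Y : Mod A} (f : X ⟶ Y) : Prop :=
  IsRightAS f ∧ ∀ h : X ⟶ X, h ≫ f = f → IsIso h

/-- `0 → L → M → N → 0` (given by the two maps `f,g`) is an almost split
(Auslander-Reiten) sequence in `mod A`. -/
structure IsASSeq {L M N : Mod A} (f : L ⟶ M) (g : M ⟶ N) : Prop where
  fdL : FD L
  fdM : FD M
  fdN : FD N
  indecL : Indec L
  indecN : Indec N
  inj : Function.Injective f
  surj : Function.Surjective g
  exact : ∀ m : M, g m = 0 ↔ ∃ l : L, f l = m
  minLeft : IsMinLeftAS f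
  minRight : IsMinRightAS g

/-- Two modules are joined by an edge of the Auslander-Reiten quiver of `A` (or are
isomorphic, hence are equal vertices of it). -/
def ARStep (X Y : Mod A) : Prop :=
  (FD X ∧ FD Y ∧ Indec X ∧ Indec Y ∧
    ((∃ f : X ⟶ Y, Irred f) ∨ (∃ f : Y ⟶ X, Irred f))) ∨ Nonempty (X ≅ Y)

/-- `X` and `Y` lie in the same component of the Auslander-Reiten quiver of `A`. -/
def SameComp : Mod A → Mod A → Prop := Relation.EqvGen ARStep

/-- The radical of a module: the intersection of its maximal submodules. -/
def modRad (M : Mod A) : Submodule A M := sInf {N : Submodule A M | IsCoatom N}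

/-- The socle of a module: the sum of its simple submodules. -/
def modSoc (M : Mod A) : Submodule A M := sSup {N : Submodule A M | IsAtom N}

variable (A) in
/-- `A` is of finite representation type. -/
def FinRepType : Prop := ∃ (ι : Type) (_ : Finite ι) (M : ι → Mod A),
  ∀ X : Mod A, FD X → Indec X → ∃ i : ι, Nonempty (X ≅ M i)

variable (A) in
/-- `A` is a connected (indecomposable) algebra: its only central idempotents are `0`, `1`. -/
def ConnectedAlgebra : Prop :=
  ∀ e : A, IsIdempotentElem e → (∀ a : A, a * e = e * a) → e = 0 ∨ e = 1

end ARDegree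

namespace ARDegree

/-- Fitting's lemma for an element of a finite dimensional algebra. -/
theorem exists_fitting_idempotent {k R : Type*} [Field k] [Ring R] [Algebra k R]
    [FiniteDimensional k R] (h : R) :
    ∃ (e w : R) (N : ℕ), e * e = e ∧ e = w * h ∧ e = h * w ∧ h ^ N * (1 - e) = 0 := by
  have hk : IsIntegral k h := Algebra.IsIntegral.isIntegral h
  obtain ⟨q, hq, hX⟩ := Polynomial.exists_eq_pow_rootMultiplicity_mul_and_not_dvd
    (minpoly k h) (minpoly.ne_zero hk) 0
  set a := (minpoly k h).rootMultiplicity 0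
  rw [map_zero, sub_zero] at hq hX
  have hcop : IsCoprime (Polynomial.X ^ (a + 1) : Polynomial k) q :=
    IsCoprime.pow_left ((Polynomial.irreducible_X.coprime_iff_not_dvd).2 hX)
  obtain ⟨u, v, huv⟩ := hcop
  have h0 : Polynomial.aeval h (Polynomial.X ^ a * q) = 0 := by
    rw [← hq, minpoly.aeval]
  have h1 : (1 : R) - Polynomial.aeval h (u * Polynomial.X ^ (a + 1)) =
      Polynomial.aeval h (v * q) := by
    rw [sub_eq_iff_eq_add', ← map_add, huv, map_one]
  have h2 : Polynomial.aeval h (u * Polynomial.X ^ (a + 1)) *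
      ((1 : R) - Polynomial.aeval h (u * Polynomial.X ^ (a + 1))) = 0 := by
    rw [h1, ← map_mul, show u * Polynomial.X ^ (a + 1) * (v * q) =
      (u * v * Polynomial.X) * (Polynomial.X ^ a * q) by ring, map_mul, h0, mul_zero]
  refine ⟨Polynomial.aeval h (u * Polynomial.X ^ (a + 1)),
    Polynomial.aeval h (u * Polynomial.X ^ a), a, ?_, ?_, ?_, ?_⟩
  · rw [mul_sub, mul_one, sub_eq_zero] at h2
    exact h2.symm
  · conv_rhs => rw [← Polynomial.aeval_X (R := k) h]
    simp only [Polynomial.aeval_X, ← mul_assoc, pow_succ, map_mul]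
  · rw [show u * Polynomial.X ^ (a + 1) = Polynomial.X * (u * Polynomial.X ^ a) by ring,
      map_mul, Polynomial.aeval_X]
  · rw [h1]
    have : h ^ a = Polynomial.aeval h (Polynomial.X ^ a : Polynomial k) := by simp
    rw [this, ← map_mul, show Polynomial.X ^ a * (v * q) = v * (Polynomial.X ^ a * q) by ring,
      map_mul, h0, mul_zero]

/-- A filtration of the morphism spaces of a `k`-linear category by the powers of its radical. -/
structure RadFiltration (k : Type*) (C : Type*) [Field k] [Category C] [Preadditive C]
    [Linear k C] where
  /-- The `n`-th power of the radical. -/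
  pow : ℕ → ∀ X Y : C, Submodule k (X ⟶ Y)
  pow_zero : ∀ X Y, pow 0 X Y = ⊤
  mem_one : ∀ {X Y : C} (f : X ⟶ Y), f ∈ pow 1 X Y ↔ ∀ g : Y ⟶ X, IsIso (𝟙 X - f ≫ g)
  comp_mem : ∀ {X Y Z : C} {f : X ⟶ Y} {g : Y ⟶ Z} (m n : ℕ), f ∈ pow m X Y → g ∈ pow n Y Z →
    f ≫ g ∈ pow (m + n) X Z
  le_span : ∀ (m n : ℕ) (X Z : C), pow (m + n) X Z ≤
    Submodule.span k {h | ∃ (Y : C) (f : X ⟶ Y) (g : Y ⟶ Z),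
      f ∈ pow m X Y ∧ g ∈ pow n Y Z ∧ h = f ≫ g}

/-- A nonzero object without nontrivial idempotent endomorphisms. -/
def NoIdem {C : Type*} [Category C] [Preadditive C] (X : C) : Prop :=
  𝟙 X ≠ 0 ∧ ∀ e : X ⟶ X, e ≫ e = e → e = 0 ∨ e = 𝟙 X

section Basic

variable {k : Type*} [Field k] {C : Type*} [Category C] [Preadditive C] [Linear k C]

theorem isIso_one_sub_swap {X Y : C} (f : X ⟶ Y) (g : Y ⟶ X) (h : IsIso (𝟙 X - f ≫ g)) :
    IsIso (𝟙 Y - g ≫ f) := by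
  obtain ⟨i, h1, h2⟩ := h
  rw [Preadditive.sub_comp, Category.id_comp, sub_eq_iff_eq_add] at h1
  rw [Preadditive.comp_sub, Category.comp_id, sub_eq_iff_eq_add] at h2
  have h3 : g ≫ i ≫ f = g ≫ f + g ≫ f ≫ g ≫ i ≫ f := by
    conv_lhs => rw [h1]
    simp
  have h4 : g ≫ i ≫ f = g ≫ f + g ≫ i ≫ f ≫ g ≫ f := by
    conv_lhs => rw [h2]
    simp
  refine ⟨𝟙 Y + g ≫ i ≫ f, ?_, ?_⟩
  · simp only [Preadditive.sub_comp, Preadditive.comp_add, Category.id_comp, Category.comp_id,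
      Category.assoc]
    nth_rw 1 [h3]
    abel
  · simp only [Preadditive.comp_sub, Preadditive.add_comp, Category.id_comp, Category.comp_id,
      Category.assoc]
    nth_rw 1 [h4]
    abel

namespace NoIdem

variable {X Y : C}

theorem isIso_of_splitMono (hY : NoIdem Y) (hX : 𝟙 X ≠ 0) (f : X ⟶ Y) (g : Y ⟶ X)
    (hfg : f ≫ g = 𝟙 X) : IsIso f := by
  rcases hY.2 (g ≫ f) (by simp [reassoc_of% hfg]) with h | h
  · refine absurd ?_ hX
    have : f ≫ (g ≫ f) ≫ g = 0 := by rw [h]; simp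
    simpa [hfg, reassoc_of% hfg] using this
  · exact ⟨g, hfg, h⟩

variable [∀ X Y : C, FiniteDimensional k (X ⟶ Y)]

theorem isIso_or_isNilpotent (k : Type*) [Field k] [Linear k C]
    [∀ X Y : C, FiniteDimensional k (X ⟶ Y)] (hX : NoIdem X) (h : End X) :
    IsIso (C := C) (X := X) (Y := X) h ∨ IsNilpotent h := by
  have : FiniteDimensional k (End X) := inferInstanceAs (FiniteDimensional k (X ⟶ X))
  obtain ⟨e, w, N, h1, h2, h3, h4⟩ := exists_fitting_idempotent (k := k) h
  rcases hX.2 e h1 with h5 | h5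
  · right
    refine ⟨N, ?_⟩
    rw [show e = 0 from h5] at h4
    simpa using h4
  · left
    exact ⟨w, h2.symm.trans h5, h3.symm.trans h5⟩

theorem isIso_or_isIso_one_sub (k : Type*) [Field k] [Linear k C]
    [∀ X Y : C, FiniteDimensional k (X ⟶ Y)] (hX : NoIdem X) (h : X ⟶ X) :
    IsIso h ∨ IsIso (𝟙 X - h) := by
  rcases hX.isIso_or_isNilpotent k (End.of h) with h1 | h1
  · exact Or.inl h1
  · exact Or.inr ((isUnit_iff_isIso _).1 h1.isUnit_one_sub)

theorem exists_scalar_not_isIso [IsAlgClosed k] (hX : NoIdem X) (h : X ⟶ X) :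
    ∃ c : k, ¬ IsIso (h - c • 𝟙 X) := by
  have : FiniteDimensional k (End X) := inferInstanceAs (FiniteDimensional k (X ⟶ X))
  have : Nontrivial (End X) := ⟨𝟙 X, 0, hX.1⟩
  obtain ⟨c, hc⟩ := spectrum.nonempty_of_isAlgClosed_of_finiteDimensional k (End.of h)
  refine ⟨c, fun hi => ?_⟩
  rw [spectrum.mem_iff] at hc
  apply hc
  have h1 : IsUnit (End.of h - algebraMap k (End X) c) := by
    rw [isUnit_iff_isIso, Algebra.algebraMap_eq_smul_one]
    exact hi
  rw [← neg_sub]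
  exact h1.neg

end NoIdem

namespace RadFiltration

variable (ρ : RadFiltration k C) {X Y Z : C}

theorem comp_mem_left {f : X ⟶ Y} (g : Y ⟶ Z) {m : ℕ} (hf : f ∈ ρ.pow m X Y) :
    f ≫ g ∈ ρ.pow m X Z := by
  have hg : g ∈ ρ.pow 0 Y Z := by rw [ρ.pow_zero]; trivial
  exact ρ.comp_mem m 0 hf hg

theorem comp_mem_right (f : X ⟶ Y) {g : Y ⟶ Z} {m : ℕ} (hg : g ∈ ρ.pow m Y Z) :
    f ≫ g ∈ ρ.pow m X Z := by
  have hf : f ∈ ρ.pow 0 X Y := by rw [ρ.pow_zero]; trivial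
  simpa using ρ.comp_mem 0 m hf hg

theorem antitone (X Y : C) : Antitone (fun m => ρ.pow m X Y) := by
  refine antitone_nat_of_succ_le fun m => ?_
  refine (ρ.le_span m 1 X Y).trans (Submodule.span_le.2 ?_)
  rintro _ ⟨W, f, g, hf, -, rfl⟩
  exact ρ.comp_mem_left g hf

theorem id_eq_zero (h : 𝟙 X ∈ ρ.pow 1 X X) : 𝟙 X = 0 := by
  have := (ρ.mem_one _).1 h (𝟙 X)
  rw [Category.id_comp, sub_self] at this
  rw [← IsIso.hom_inv_id (0 : X ⟶ X), Limits.zero_comp]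

theorem not_isSplitMono {f : X ⟶ Y} (hf : f ∈ ρ.pow 1 X Y) (hX : 𝟙 X ≠ 0) :
    ¬ IsSplitMono f := fun h => hX (ρ.id_eq_zero (by
  rw [← IsSplitMono.id f]
  exact ρ.comp_mem_left _ hf))

theorem not_isSplitEpi {f : X ⟶ Y} (hf : f ∈ ρ.pow 1 X Y) (hY : 𝟙 Y ≠ 0) :
    ¬ IsSplitEpi f := fun h => hY (ρ.id_eq_zero (by
  rw [← IsSplitEpi.id f]
  exact ρ.comp_mem_right _ hf))

variable [∀ X Y : C, FiniteDimensional k (X ⟶ Y)]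

theorem mem_one_of_not_isSplitMono (hX : NoIdem X) {f : X ⟶ Y} (hf : ¬ IsSplitMono f) :
    f ∈ ρ.pow 1 X Y := by
  refine (ρ.mem_one f).2 fun g => (hX.isIso_or_isIso_one_sub k (f ≫ g)).resolve_left fun h => hf ?_
  exact IsSplitMono.mk' ⟨g ≫ inv (f ≫ g), by rw [← Category.assoc, IsIso.hom_inv_id]⟩

theorem mem_one_of_not_isSplitEpi (hY : NoIdem Y) {f : X ⟶ Y} (hf : ¬ IsSplitEpi f) :
    f ∈ ρ.pow 1 X Y := by
  refine (ρ.mem_one f).2 fun g => isIso_one_sub_swap _ _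
    ((hY.isIso_or_isIso_one_sub k (g ≫ f)).resolve_left fun h => hf ?_)
  exact IsSplitEpi.mk' ⟨inv (g ≫ f) ≫ g, by rw [Category.assoc, IsIso.inv_hom_id]⟩

theorem mem_one_of_not_isIso (hX : NoIdem X) (hY : NoIdem Y) {f : X ⟶ Y} (hf : ¬ IsIso f) :
    f ∈ ρ.pow 1 X Y :=
  ρ.mem_one_of_not_isSplitMono hX fun _ =>
    hf (hY.isIso_of_splitMono hX.1 f (retraction f) (IsSplitMono.id f))

end RadFiltration

end Basic

section KrullSchmidt

variable {C : Type*} [Category C] [Preadditive C]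

/-- A decomposition of an object as a finite biproduct of members of a family of objects. -/
structure Decomp {R : Type*} (ob : R → C) (X : C) where
  /-- The index set of the decomposition. -/
  ι : Type
  [fintype : Fintype ι]
  /-- The summands. -/
  s : ι → R
  /-- The projections. -/
  p : ∀ i, X ⟶ ob (s i)
  /-- The inclusions. -/
  q : ∀ i, ob (s i) ⟶ X
  qp_self : ∀ i, q i ≫ p i = 𝟙 _
  qp_ne : ∀ i j, i ≠ j → q i ≫ p j = 0
  sum_pq : ∑ i, p i ≫ q i = 𝟙 X

attribute [instance] Decomp.fintype

theorem finrank_end_lt (k : Type*) [Field k] [Linear k C] [∀ X Y : C, FiniteDimensional k (X ⟶ Y)]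
    {X Y : C} {i : Y ⟶ X} {p : X ⟶ Y} (h : i ≫ p = 𝟙 Y) (hp : p ≫ i ≠ 𝟙 X) :
    Module.finrank k (Y ⟶ Y) < Module.finrank k (X ⟶ X) := by
  let L : (Y ⟶ Y) →ₗ[k] (X ⟶ X) := Linear.leftComp k X p ∘ₗ Linear.rightComp k Y i
  have hL : ∀ y, L y = p ≫ y ≫ i := fun y => rfl
  have hinj : Function.Injective L := by
    intro y z hyz
    have := congrArg (fun t => i ≫ t ≫ p) hyz
    simpa [hL, h, reassoc_of% h] using this
  rw [← LinearMap.finrank_range_of_inj hinj]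
  refine Submodule.finrank_lt fun htop => hp ?_
  obtain ⟨y, hy⟩ := LinearMap.range_eq_top.1 htop (𝟙 X)
  rw [hL] at hy
  calc p ≫ i = (p ≫ y ≫ i) ≫ p ≫ i := by rw [hy, Category.id_comp]
    _ = p ≫ y ≫ i := by simp [reassoc_of% h]
    _ = 𝟙 X := hy

namespace Decomp

variable {R : Type*} {ob : R → C}

/-- Glue decompositions of two complementary direct summands. -/
def glue {X Y Y' : C} {i : Y ⟶ X} {p : X ⟶ Y} {i' : Y' ⟶ X} {p' : X ⟶ Y'}
    (h : i ≫ p = 𝟙 Y) (h' : i' ≫ p' = 𝟙 Y') (hs : p ≫ i + p' ≫ i' = 𝟙 X)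
    (h0 : i ≫ p' = 0) (h0' : i' ≫ p = 0) (d : Decomp ob Y) (d' : Decomp ob Y') :
    Decomp ob X where
  ι := d.ι ⊕ d'.ι
  s := Sum.elim d.s d'.s
  p := fun a => match a with
    | .inl a => p ≫ d.p a
    | .inr a => p' ≫ d'.p a
  q := fun a => match a with
    | .inl a => d.q a ≫ i
    | .inr a => d'.q a ≫ i'
  qp_self := by
    rintro (a | a)
    · simpa [reassoc_of% h] using d.qp_self a
    · simpa [reassoc_of% h'] using d'.qp_self a
  qp_ne := by
    rintro (a | a) (b | b) hab
    · change (d.q a ≫ i) ≫ p ≫ d.p b = 0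
      simpa [reassoc_of% h] using d.qp_ne a b (fun hh => hab (hh ▸ rfl))
    · change (d.q a ≫ i) ≫ p' ≫ d'.p b = 0
      simp [reassoc_of% h0]
    · change (d'.q a ≫ i') ≫ p ≫ d.p b = 0
      simp [reassoc_of% h0']
    · change (d'.q a ≫ i') ≫ p' ≫ d'.p b = 0
      simpa [reassoc_of% h'] using d'.qp_ne a b (fun hh => hab (hh ▸ rfl))
  sum_pq := by
    rw [Fintype.sum_sum_type, ← hs]
    congr 1
    · calc _ = p ≫ (∑ a, d.p a ≫ d.q a) ≫ i := by
            rw [Preadditive.sum_comp, Preadditive.comp_sum]; simp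
        _ = _ := by rw [d.sum_pq]; simp
    · calc _ = p' ≫ (∑ a, d'.p a ≫ d'.q a) ≫ i' := by
            rw [Preadditive.sum_comp, Preadditive.comp_sum]; simp
        _ = _ := by rw [d'.sum_pq]; simp

theorem comp_eq_sum {X Y Z : C} (d : Decomp ob Y) (f : X ⟶ Y) (g : Y ⟶ Z) :
    f ≫ g = ∑ i, (f ≫ d.p i) ≫ d.q i ≫ g := by
  conv_lhs => rw [← Category.id_comp g, ← d.sum_pq]
  simp [Preadditive.sum_comp, Preadditive.comp_sum]

/-- Every object of a Hom-finite idempotent complete category is a finite biproduct of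
objects without nontrivial idempotents. -/
theorem exists_decomp (k : Type*) [Field k] [Linear k C]
    [∀ X Y : C, FiniteDimensional k (X ⟶ Y)] [IsIdempotentComplete C]
    (hob : ∀ V : C, NoIdem V → ∃ r, Nonempty (V ≅ ob r)) (X : C) : Nonempty (Decomp ob X) := by
  induction hn : Module.finrank k (X ⟶ X) using Nat.strong_induction_on generalizing X with
  | _ n ih =>
  by_cases h0 : 𝟙 X = 0
  · exact ⟨{ ι := Empty, s := Empty.elim, p := fun i => i.elim, q := fun i => i.elim,
             qp_self := fun i => i.elim, qp_ne := fun i => i.elim, sum_pq := by simp [h0] }⟩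
  by_cases hX : NoIdem X
  · obtain ⟨r, ⟨f⟩⟩ := hob X hX
    exact ⟨{ ι := Unit, s := fun _ => r, p := fun _ => f.hom, q := fun _ => f.inv,
             qp_self := by simp, qp_ne := fun i j h => absurd rfl h, sum_pq := by simp }⟩
  simp only [NoIdem, not_and, not_forall, not_or] at hX
  obtain ⟨e, he, he0, he1⟩ := hX h0
  obtain ⟨Y, i, p, h1, h2⟩ := IsIdempotentComplete.idempotents_split X e he
  obtain ⟨Y', i', p', h1', h2'⟩ := IsIdempotentComplete.idempotents_split X (𝟙 X - e)
    (by simp [Preadditive.sub_comp, Preadditive.comp_sub, he])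
  have hY := finrank_end_lt k h1 (h2.trans_ne he1)
  have hY' := finrank_end_lt k h1' (by rw [h2']; simpa using he0)
  obtain ⟨d⟩ := ih _ (hn ▸ hY) Y rfl
  obtain ⟨d'⟩ := ih _ (hn ▸ hY') Y' rfl
  have h3 : i ≫ p' = 0 := by
    calc i ≫ p' = (i ≫ p) ≫ i ≫ p' ≫ i' ≫ p' := by simp [h1, h1']
      _ = i ≫ e ≫ (𝟙 X - e) ≫ p' := by rw [← h2', ← h2]; simp only [Category.assoc]
      _ = 0 := by simp [Preadditive.sub_comp, reassoc_of% he]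
  have h4 : i' ≫ p = 0 := by
    calc i' ≫ p = (i' ≫ p') ≫ i' ≫ p ≫ i ≫ p := by simp [h1, h1']
      _ = i' ≫ (𝟙 X - e) ≫ e ≫ p := by rw [← h2', ← h2]; simp only [Category.assoc]
      _ = 0 := by simp [Preadditive.sub_comp, reassoc_of% he]
  exact ⟨glue h1 h1' (by rw [h2, h2']; abel) h3 h4 d d'⟩

end Decomp

end KrullSchmidt

section AlmostSplit

variable {k : Type*} [Field k] {C : Type*} [Category C] [Abelian C] [Linear k C]

variable (k C) in
/-- A pair of objects `P`, `I` such that `Hom(P, -)` is dual to `Hom(-, I)`, the duality being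
given by a linear form on `Hom(P, I)`. -/
structure NakayamaPair where
  /-- The source object. -/
  P : C
  /-- The target object. -/
  I : C
  /-- The linear form defining the duality. -/
  tr : (P ⟶ I) →ₗ[k] k
  eq_zero_left : ∀ (M : C) (i : M ⟶ I), (∀ x : P ⟶ M, tr (x ≫ i) = 0) → i = 0
  eq_zero_right : ∀ (M : C) (x : P ⟶ M), (∀ i : M ⟶ I, tr (x ≫ i) = 0) → x = 0

theorem NakayamaPair.exists_repr [∀ X Y : C, FiniteDimensional k (X ⟶ Y)] (S : NakayamaPair k C)
    {M : C} (l : (S.P ⟶ M) →ₗ[k] k) : ∃ i : M ⟶ S.I, ∀ x, l x = S.tr (x ≫ i) := by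
  let B : (S.P ⟶ M) →ₗ[k] (M ⟶ S.I) →ₗ[k] k := (Linear.comp S.P M S.I).compr₂ S.tr
  have hB : ∀ x i, B x i = S.tr (x ≫ i) := fun x i => rfl
  have h1 : Function.Injective B := by
    rw [← LinearMap.ker_eq_bot, LinearMap.ker_eq_bot']
    exact fun x hx => S.eq_zero_right M x fun i => by rw [← hB, hx]; rfl
  have h2 : Function.Injective B.flip := by
    rw [← LinearMap.ker_eq_bot, LinearMap.ker_eq_bot']
    exact fun i hi => S.eq_zero_left M i fun x => by
      rw [← hB, ← LinearMap.flip_apply, hi]; rfl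
  have e1 := LinearMap.finrank_le_finrank_of_injective h1
  have e2 := LinearMap.finrank_le_finrank_of_injective h2
  rw [Subspace.dual_finrank_eq] at e1 e2
  have h3 := (LinearMap.injective_iff_surjective_of_finrank_eq_finrank
    (f := B.flip) (by rw [Subspace.dual_finrank_eq]; omega)).1 h2
  obtain ⟨i, hi⟩ := h3 l
  exact ⟨i, fun x => by rw [← hB, ← hi]; rfl⟩

/-- `g` is a radical morphism through which all radical morphisms with the same target factor. -/
def RightAlmostSplit (ρ : RadFiltration k C) {E V : C} (g : E ⟶ V) : Prop :=
  g ∈ ρ.pow 1 E V ∧ ∀ (M : C) (r : M ⟶ V), r ∈ ρ.pow 1 M V → ∃ t : M ⟶ E, t ≫ g = r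

variable [∀ X Y : C, FiniteDimensional k (X ⟶ Y)] (ρ : RadFiltration k C)

theorem exists_rightAlmostSplit
    (hP : ∀ M : C, ∃ (S : NakayamaPair k C) (π : S.P ⟶ M), Epi π) {V : C} (hV : NoIdem V) :
    ∃ (E : C) (g : E ⟶ V), RightAlmostSplit ρ g := by
  obtain ⟨S, π, hπ⟩ := hP V
  obtain ⟨S', p', hp'⟩ := hP (Limits.kernel π)
  set p := p' ≫ Limits.kernel.ι π with hp
  obtain ⟨ε, hε1, hε⟩ := Submodule.exists_dual_map_eq_bot_of_notMem (p := ρ.pow 1 V V)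
    (x := 𝟙 V) (fun h => hV.1 (ρ.id_eq_zero h)) inferInstance
  have hε0 : ∀ x ∈ ρ.pow 1 V V, ε x = 0 := fun x hx => by
    rw [← Submodule.mem_bot k, ← hε]
    exact Submodule.mem_map_of_mem hx
  obtain ⟨L, hL⟩ := LinearMap.exists_leftInverse_of_injective (Linear.leftComp k V π) (by
    rw [LinearMap.ker_eq_bot']
    intro e he
    exact (cancel_epi π).1 (he.trans Limits.comp_zero.symm))
  obtain ⟨l, hl⟩ := S.exists_repr (ε ∘ₗ L)
  have hl' : ∀ e : V ⟶ V, S.tr (π ≫ e ≫ l) = ε e := fun e => by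
    have := LinearMap.congr_fun hL e
    simp only [LinearMap.comp_apply, Linear.leftComp_apply, LinearMap.id_apply] at this
    rw [← Category.assoc, ← hl, LinearMap.comp_apply, this]
  obtain ⟨ν, hν⟩ := S.exists_repr (S'.tr ∘ₗ Linear.leftComp k S'.I p)
  simp only [LinearMap.comp_apply, Linear.leftComp_apply] at hν
  have hpπ : p ≫ π = 0 := by simp [hp]
  refine ⟨Limits.pullback l ν, Limits.pullback.fst l ν,
    ρ.mem_one_of_not_isSplitEpi hV fun h => hε1 ?_, fun M r hr => ?_⟩
  · have h1 : l = (section_ (Limits.pullback.fst l ν) ≫ Limits.pullback.snd l ν) ≫ ν := by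
      rw [Category.assoc, ← Limits.pullback.condition, ← Category.assoc, IsSplitEpi.id,
        Category.id_comp]
    rw [← hl', Category.id_comp, h1, ← Category.assoc, ← hν, ← Category.assoc, hpπ,
      Limits.zero_comp, map_zero]
  · have h1 : S.tr ∘ₗ Linear.rightComp k S.P (r ≫ l) ∈
        (LinearMap.ker (Linear.leftComp k M p)).dualAnnihilator := by
      rw [Submodule.mem_dualAnnihilator]
      intro x hx
      have hx' : Limits.kernel.ι π ≫ x = 0 := by
        rw [← cancel_epi p', ← Category.assoc, Limits.comp_zero]
        exact hx
      rw [LinearMap.comp_apply, Linear.rightComp_apply, ← Abelian.comp_epiDesc π x hx']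
      have := hl' (Abelian.epiDesc π x hx' ≫ r)
      rw [hε0 _ (ρ.comp_mem_right _ hr)] at this
      simpa using this
    rw [← LinearMap.range_dualMap_eq_dualAnnihilator_ker] at h1
    obtain ⟨ψ, hψ⟩ := h1
    obtain ⟨i, hi⟩ := S'.exists_repr ψ
    have h2 : r ≫ l = i ≫ ν := by
      rw [← sub_eq_zero]
      refine S.eq_zero_left M _ fun x => ?_
      have h3 : ψ (p ≫ x) = S.tr (x ≫ r ≫ l) := LinearMap.congr_fun hψ x
      rw [Preadditive.comp_sub, map_sub, ← h3, hi, ← Category.assoc x i, ← hν, Category.assoc,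
        sub_self]
    exact ⟨Limits.pullback.lift r i h2, Limits.pullback.lift_fst _ _ _⟩

theorem exists_minimal_rightAlmostSplit
    (hP : ∀ M : C, ∃ (S : NakayamaPair k C) (π : S.P ⟶ M), Epi π) {V : C} (hV : NoIdem V) :
    ∃ (E : C) (g : E ⟶ V), RightAlmostSplit ρ g ∧ ∀ h : E ⟶ E, h ≫ g = g → IsIso h := by
  classical
  have hex : ∃ n : ℕ, ∃ (E : C) (g : E ⟶ V), RightAlmostSplit ρ g ∧
      Module.finrank k (E ⟶ E) = n := by
    obtain ⟨E, g, hg⟩ := exists_rightAlmostSplit ρ hP hV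
    exact ⟨_, E, g, hg, rfl⟩
  obtain ⟨E, g, hg, hn⟩ := Nat.find_spec hex
  refine ⟨E, g, hg, fun h hh => ?_⟩
  have : FiniteDimensional k (End E) := inferInstanceAs (FiniteDimensional k (E ⟶ E))
  obtain ⟨e, w, N, h1, h2, h3, h4⟩ := exists_fitting_idempotent (k := k) (End.of h)
  have hN : ∀ m : ℕ, ((End.of h) ^ m : End E).asHom ≫ g = g := by
    intro m
    induction m with
    | zero => simp
    | succ m ih =>
      rw [pow_succ]
      change (h ≫ ((End.of h) ^ m : End E).asHom) ≫ g = g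
      rw [Category.assoc, ih, hh]
  have he : e.asHom ≫ g = g := by
    have h5 : (𝟙 E - e.asHom) ≫ ((End.of h) ^ N : End E).asHom = 0 := h4
    have h6 := congrArg (fun t => t ≫ g) h5
    simp only [Category.assoc, hN, Preadditive.sub_comp, Category.id_comp, Limits.zero_comp] at h6
    exact (sub_eq_zero.1 h6).symm
  by_cases h1' : e.asHom = 𝟙 E
  · exact ⟨w, h2.symm.trans h1', h3.symm.trans h1'⟩
  obtain ⟨Y, i, p, hi, hp⟩ := IsIdempotentComplete.idempotents_split E e.asHom h1
  refine absurd ⟨Y, i ≫ g, ⟨ρ.comp_mem_right _ hg.1, fun M r hr => ?_⟩, rfl⟩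
    (Nat.find_min hex (m := Module.finrank k (Y ⟶ Y))
      (hn ▸ finrank_end_lt k hi (hp.trans_ne h1')))
  obtain ⟨t, rfl⟩ := hg.2 M r hr
  exact ⟨t ≫ p, by rw [Category.assoc, ← Category.assoc p, hp, he]⟩

end AlmostSplit

section Mesh

variable {k : Type*} [Field k] {C : Type*} [Category C] [Abelian C] [Linear k C]

/-- `a` is a kernel of `g` with cokernel `g`, and all radical morphisms starting at `T` factor
through the radical morphism `a`. -/
structure IsMeshKernel (ρ : RadFiltration k C) {T E V : C} (a : T ⟶ E) (g : E ⟶ V) : Prop where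
  mono : Mono a
  mem : a ∈ ρ.pow 1 T E
  comp_eq_zero : a ≫ g = 0
  lift : ∀ (M : C) (x : M ⟶ E), x ≫ g = 0 → ∃ w : M ⟶ T, w ≫ a = x
  desc : ∀ (M : C) (t : E ⟶ M), a ≫ t = 0 → ∃ s : V ⟶ M, g ≫ s = t
  fact : ∀ (M : C) (r : T ⟶ M), r ∈ ρ.pow 1 T M → ∃ t : E ⟶ M, a ≫ t = r

variable {ρ : RadFiltration k C}

theorem IsMeshKernel.of_iso {T T' E E' V : C} {a : T ⟶ E} {g : E ⟶ V} (h : IsMeshKernel ρ a g)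
    (φ : T' ≅ T) (ψ : E ≅ E') : IsMeshKernel ρ (φ.hom ≫ a ≫ ψ.hom) (ψ.inv ≫ g) where
  mono := by
    have := h.mono
    infer_instance
  mem := ρ.comp_mem_right _ (ρ.comp_mem_left _ h.mem)
  comp_eq_zero := by simp [h.comp_eq_zero]
  lift M x hx := by
    obtain ⟨w, hw⟩ := h.lift M (x ≫ ψ.inv) (by simpa using hx)
    exact ⟨w ≫ φ.inv, by simp [reassoc_of% hw]⟩
  desc M t ht := by
    obtain ⟨s, hs⟩ := h.desc M (ψ.hom ≫ t) (by
      rw [← cancel_epi φ.hom]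
      simpa using ht)
    exact ⟨s, by simp [hs]⟩
  fact M r hr := by
    obtain ⟨t, ht⟩ := h.fact M (φ.inv ≫ r) (ρ.comp_mem_right _ hr)
    exact ⟨ψ.inv ≫ t, by simp [ht]⟩

variable [∀ X Y : C, FiniteDimensional k (X ⟶ Y)] {E V : C} {g : E ⟶ V}

theorem RightAlmostSplit.mono_or_epi (hg : RightAlmostSplit ρ g) (hV : NoIdem V)
    (hmin : ∀ h : E ⟶ E, h ≫ g = g → IsIso h) : Mono g ∨ Epi g := by
  rw [or_iff_not_imp_right]
  intro hne
  have h1 : ¬ IsSplitEpi (Limits.image.ι g) := fun h => hne (by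
    rw [← Limits.image.fac g]
    infer_instance)
  obtain ⟨t, ht⟩ := hg.2 _ _ (ρ.mem_one_of_not_isSplitEpi hV h1)
  have h2 := hmin (Limits.factorThruImage g ≫ t) (by rw [Category.assoc, ht, Limits.image.fac])
  have h3 : Mono (Limits.factorThruImage g) := mono_of_mono _ t
  rw [← Limits.image.fac g]
  infer_instance

/-- A morphism starting at the kernel of a minimal right almost split epimorphism is a split
monomorphism or extends along the kernel. -/
theorem RightAlmostSplit.exists_kernel_fact (hg : RightAlmostSplit ρ g) (hV : NoIdem V)
    (hmin : ∀ h : E ⟶ E, h ≫ g = g → IsIso h) [Epi g] {U : C} (u : Limits.kernel g ⟶ U)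
    (hu : ¬ IsSplitMono u) : ∃ t : E ⟶ U, Limits.kernel.ι g ≫ t = u := by
  set a := Limits.kernel.ι g with ha
  have hag : a ≫ g = 0 := Limits.kernel.condition g
  set i := Limits.pushout.inl a u
  set j := Limits.pushout.inr a u
  have hij : a ≫ i = u ≫ j := Limits.pushout.condition
  have hj : Mono j := inferInstance
  set d : Limits.pushout a u ⟶ V := Limits.pushout.desc g 0 (by simp [hag])
  have hid : i ≫ d = g := Limits.pushout.inl_desc _ _ _
  have hjd : j ≫ d = 0 := Limits.pushout.inr_desc _ _ _
  by_cases hd : IsSplitEpi d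
  · have hπ : ∃ z, d ≫ z = Limits.cokernel.π j := by
      have h0 : a ≫ i ≫ Limits.cokernel.π j = 0 := by
        rw [← Category.assoc, hij, Category.assoc, Limits.cokernel.condition, Limits.comp_zero]
      refine ⟨Abelian.epiDesc g _ h0, Limits.pushout.hom_ext ?_ ?_⟩
      · change i ≫ d ≫ _ = _
        rw [← Category.assoc, hid, Abelian.comp_epiDesc]
      · change j ≫ d ≫ _ = j ≫ _
        rw [← Category.assoc, hjd, Limits.zero_comp, Limits.cokernel.condition]
    obtain ⟨z, hz⟩ := hπ
    have h1 : (i - g ≫ section_ d) ≫ Limits.cokernel.π j = 0 := by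
      rw [← hz, ← Category.assoc, Preadditive.sub_comp, hid, Category.assoc, IsSplitEpi.id]
      simp
    refine ⟨Abelian.monoLift j _ h1, ?_⟩
    rw [← cancel_mono j, Category.assoc, Abelian.monoLift_comp, Preadditive.comp_sub, hij,
      ← Category.assoc a, hag]
    simp
  · obtain ⟨w, hw⟩ := hg.2 _ _ (ρ.mem_one_of_not_isSplitEpi hV hd)
    have hiw := hmin (i ≫ w) (by rw [Category.assoc, hw, hid])
    have hinv : inv (i ≫ w) ≫ g = g := by
      rw [IsIso.inv_comp_eq, Category.assoc, hw, hid]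
    have hl1 : (j ≫ w) ≫ g = 0 := by rw [Category.assoc, hw, hjd]
    have hl2 : (a ≫ inv (i ≫ w)) ≫ g = 0 := by rw [Category.assoc, hinv, hag]
    have h1 : Limits.kernel.lift g _ hl1 ≫ a = j ≫ w := Limits.kernel.lift_ι _ _ _
    have h2 : Limits.kernel.lift g _ hl2 ≫ a = a ≫ inv (i ≫ w) := Limits.kernel.lift_ι _ _ _
    refine absurd (IsSplitMono.mk' ⟨Limits.kernel.lift g _ hl1 ≫ Limits.kernel.lift g _ hl2, ?_⟩) hu
    rw [← cancel_mono a, Category.assoc, Category.assoc, h2, ← Category.assoc _ a, h1,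
      ← Category.assoc u, ← Category.assoc u, ← hij, Category.id_comp, Category.assoc a,
      Category.assoc, IsIso.hom_inv_id, Category.comp_id]

theorem RightAlmostSplit.isMeshKernel (hg : RightAlmostSplit ρ g) (hV : NoIdem V)
    (hmin : ∀ h : E ⟶ E, h ≫ g = g → IsIso h) (hepi : Epi g) (hmono : ¬ Mono g) :
    NoIdem (Limits.kernel g) ∧ IsMeshKernel ρ (Limits.kernel.ι g) g := by
  have hns : ¬ IsSplitMono (Limits.kernel.ι g) := by
    intro hs
    set a := Limits.kernel.ι g with ha
    have hag : a ≫ g = 0 := Limits.kernel.condition g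
    have h1 : a ≫ (𝟙 E - retraction a ≫ a) = 0 := by
      rw [Preadditive.comp_sub, IsSplitMono.id_assoc, Category.comp_id, sub_self]
    refine ρ.not_isSplitEpi hg.1 hV.1 (IsSplitEpi.mk' ⟨Abelian.epiDesc g _ h1, ?_⟩)
    rw [← cancel_epi g, ← Category.assoc, Abelian.comp_epiDesc, Preadditive.sub_comp,
      Category.assoc, hag]
    simp
  have hK : NoIdem (Limits.kernel g) := by
    refine ⟨fun h0 => hmono (Preadditive.mono_of_kernel_zero ?_), fun e he => ?_⟩
    · rw [← Category.id_comp (Limits.kernel.ι g), h0, Limits.zero_comp]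
    have key : ∀ e : Limits.kernel g ⟶ Limits.kernel g, e ≫ e = e → IsSplitMono e → e = 𝟙 _ :=
      fun e he hs => (cancel_mono e).1 (by rw [he, Category.id_comp])
    by_cases h1 : IsSplitMono e
    · exact Or.inr (key e he h1)
    by_cases h2 : IsSplitMono (𝟙 _ - e)
    · left
      simpa using key _ (by simp [Preadditive.sub_comp, Preadditive.comp_sub, he]) h2
    obtain ⟨t, ht⟩ := hg.exists_kernel_fact hV hmin e h1
    obtain ⟨t', ht'⟩ := hg.exists_kernel_fact hV hmin _ h2
    exact absurd (IsSplitMono.mk' ⟨t + t', by rw [Preadditive.comp_add, ht, ht']; abel⟩) hns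
  refine ⟨hK, inferInstance, ρ.mem_one_of_not_isSplitMono hK hns, Limits.kernel.condition g,
    fun M x hx => ⟨Limits.kernel.lift g x hx, Limits.kernel.lift_ι _ _ _⟩,
    fun M t ht => ⟨Abelian.epiDesc g t ht, Abelian.comp_epiDesc _ _ _⟩,
    fun M r hr => hg.exists_kernel_fact hV hmin r (ρ.not_isSplitMono hr hK.1)⟩

/-- Existence of almost split sequences. -/
theorem exists_almostSplit (ρ : RadFiltration k C)
    (hP : ∀ M : C, ∃ (S : NakayamaPair k C) (π : S.P ⟶ M), Epi π) {V : C} (hV : NoIdem V)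
    {R : Type*} {ob : R → C} (hob : ∀ V : C, NoIdem V → ∃ r, Nonempty (V ≅ ob r)) :
    ∃ (E : C) (g : E ⟶ V), RightAlmostSplit ρ g ∧
      (Mono g ∨ ∃ (T : R) (a : ob T ⟶ E), IsMeshKernel ρ a g) := by
  obtain ⟨E, g, hg, hmin⟩ := exists_minimal_rightAlmostSplit ρ hP hV
  refine ⟨E, g, hg, ?_⟩
  rw [or_iff_not_imp_left]
  intro hmono
  obtain ⟨hK, h⟩ := hg.isMeshKernel hV hmin ((hg.mono_or_epi hV hmin).resolve_left hmono) hmono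
  obtain ⟨T, ⟨φ⟩⟩ := hob _ hK
  exact ⟨T, φ.inv ≫ Limits.kernel.ι g, by simpa using h.of_iso φ.symm (Iso.refl E)⟩

end Mesh

section Sinks

variable {k : Type*} [Field k] {C : Type*} [Category C] [Abelian C] [Linear k C]

/-- A family of representatives of the isomorphism classes of objects without nontrivial
idempotents. -/
structure IsSkeletal {R : Type*} (ob : R → C) : Prop where
  noIdem : ∀ r, NoIdem (ob r)
  exists_iso : ∀ V : C, NoIdem V → ∃ r, Nonempty (V ≅ ob r)
  eq_of_iso : ∀ r s, Nonempty (ob r ≅ ob s) → r = s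

open Classical in
/-- The multiple of the identity by `c` if `W = U`, zero otherwise. -/
noncomputable def scal {R : Type*} (ob : R → C) (c : k) (W U : R) : ob W ⟶ ob U :=
  if h : W = U then c • eqToHom (congrArg ob h) else 0

variable {R : Type*} {ob : R → C} {ρ : RadFiltration k C}

theorem scal_comp_mem {Z : C} (J : ∀ V : R, Submodule k (ob V ⟶ Z)) (c : k) (W U : R)
    {x : ob U ⟶ Z} (hx : x ∈ J U) : scal ob c W U ≫ x ∈ J W := by
  by_cases h : W = U
  · subst h
    simpa [scal] using (J W).smul_mem c hx
  · simp [scal, h]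

theorem comp_scal_mem {Z : C} (J : ∀ V : R, Submodule k (Z ⟶ ob V)) (c : k) (W U : R)
    {x : Z ⟶ ob W} (hx : x ∈ J W) : x ≫ scal ob c W U ∈ J U := by
  by_cases h : W = U
  · subst h
    simpa [scal] using (J W).smul_mem c hx
  · simp [scal, h]

theorem scal_add (c c' : k) (W U : R) :
    scal ob (c + c') W U = scal ob c W U + scal ob c' W U := by
  by_cases h : W = U <;> simp [scal, h, add_smul]

theorem smul_scal (c c' : k) (W U : R) : c • scal ob c' W U = scal ob (c * c') W U := by
  by_cases h : W = U <;> simp [scal, h, mul_smul]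

theorem scal_zero (W U : R) : scal ob (0 : k) W U = 0 := by
  by_cases h : W = U <;> simp [scal, h]

theorem IsSkeletal.scal_eq_zero (hs : IsSkeletal ob) {c : k} {W U : R}
    (h : scal ob c W U ∈ ρ.pow 1 (ob W) (ob U)) : scal ob c W U = 0 := by
  by_cases hWU : W = U
  · subst hWU
    simp only [scal, dite_true, eqToHom_refl] at h ⊢
    by_cases hc : c = 0
    · simp [hc]
    · exact absurd (ρ.id_eq_zero (((ρ.pow 1 _ _).smul_mem_iff hc).1 h)) (hs.noIdem W).1
  · simp [scal, hWU]

theorem IsSkeletal.exists_scal [IsAlgClosed k] [∀ X Y : C, FiniteDimensional k (X ⟶ Y)]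
    (hs : IsSkeletal ob) {W U : R} (t : ob W ⟶ ob U) :
    ∃ c : k, t - scal ob c W U ∈ ρ.pow 1 (ob W) (ob U) := by
  by_cases hWU : W = U
  · subst hWU
    obtain ⟨c, hc⟩ := (hs.noIdem W).exists_scalar_not_isIso (k := k) t
    exact ⟨c, ρ.mem_one_of_not_isIso (hs.noIdem W) (hs.noIdem W) (by simpa [scal] using hc)⟩
  · exact ⟨0, by
      rw [scal_zero, sub_zero]
      exact ρ.mem_one_of_not_isIso (hs.noIdem W) (hs.noIdem U)
        fun h => hWU (hs.eq_of_iso _ _ ⟨asIso t⟩)⟩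

/-- A choice of complements of the square of the radical in the radical. -/
structure Good (ρ : RadFiltration k C) (I : ∀ W V : R, Submodule k (ob W ⟶ ob V)) : Prop where
  le : ∀ W V, I W V ≤ ρ.pow 1 (ob W) (ob V)
  eq_zero : ∀ W V, ∀ x ∈ I W V, x ∈ ρ.pow 2 (ob W) (ob V) → x = 0
  le_sup : ∀ W V, ρ.pow 1 (ob W) (ob V) ≤ I W V ⊔ ρ.pow 2 (ob W) (ob V)

theorem RadFiltration.exists_complement (ρ : RadFiltration k C) {X Y : C}
    (S : Submodule k (X ⟶ Y)) (hS : S ≤ ρ.pow 1 X Y)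
    (h : ∀ x ∈ S, x ∈ ρ.pow 2 X Y → x = 0) :
    ∃ J : Submodule k (X ⟶ Y), S ≤ J ∧ J ≤ ρ.pow 1 X Y ∧ (∀ x ∈ J, x ∈ ρ.pow 2 X Y → x = 0) ∧
      ρ.pow 1 X Y ≤ J ⊔ ρ.pow 2 X Y := by
  obtain ⟨J, hJ, hc⟩ := (Submodule.disjoint_def.2 h).exists_isCompl
  refine ⟨J ⊓ ρ.pow 1 X Y, le_inf hJ hS, inf_le_right,
    fun x hx => Submodule.disjoint_def.1 hc.disjoint x hx.1, ?_⟩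
  intro x hx
  obtain ⟨y, hy, z, hz, rfl⟩ := Submodule.mem_sup.1 (hc.sup_eq_top ▸ Submodule.mem_top (x := x))
  have hz' := ρ.antitone X Y one_le_two hz
  exact Submodule.mem_sup.2 ⟨y, ⟨hy, by simpa using (ρ.pow 1 X Y).sub_mem hx hz'⟩, z, hz, rfl⟩

theorem RightAlmostSplit.exists_lift {E V : C} {g : E ⟶ V} (hg : RightAlmostSplit ρ g) {M : C}
    (m : ℕ) {x : M ⟶ V} (hx : x ∈ ρ.pow (m + 1) M V) : ∃ y ∈ ρ.pow m M E, y ≫ g = x := by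
  have h : ρ.pow (m + 1) M V ≤ (ρ.pow m M E).map (Linear.rightComp k M g) := by
    refine (ρ.le_span m 1 M V).trans (Submodule.span_le.2 ?_)
    rintro _ ⟨Y, f, r, hf, hr, rfl⟩
    obtain ⟨t, rfl⟩ := hg.2 _ _ hr
    exact ⟨f ≫ t, ρ.comp_mem_left _ hf, Category.assoc _ _ _⟩
  exact h hx

theorem IsMeshKernel.exists_extension {T E V : C} {a : T ⟶ E} {g : E ⟶ V}
    (h : IsMeshKernel ρ a g) {M : C} {x : T ⟶ M} (hx : x ∈ ρ.pow 2 T M) :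
    ∃ y ∈ ρ.pow 1 E M, a ≫ y = x := by
  have h : ρ.pow (1 + 1) T M ≤ (ρ.pow 1 E M).map (Linear.leftComp k M a) := by
    refine (ρ.le_span 1 1 T M).trans (Submodule.span_le.2 ?_)
    rintro _ ⟨Y, f, r, hf, hr, rfl⟩
    obtain ⟨t, rfl⟩ := h.fact _ _ hf
    exact ⟨t ≫ r, ρ.comp_mem_right _ hr, (Category.assoc _ _ _).symm⟩
  exact h hx

/-- A right almost split morphism whose components lie in the prescribed complements. -/
structure Sink (ρ : RadFiltration k C) (I : ∀ W V : R, Submodule k (ob W ⟶ ob V)) (V : R) where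
  /-- The source. -/
  E : C
  /-- The right almost split morphism. -/
  g : E ⟶ ob V
  /-- A decomposition of the source. -/
  d : Decomp ob E
  ras : RightAlmostSplit ρ g
  mem : ∀ a, d.q a ≫ g ∈ I (d.s a) V
  mesh : Mono g ∨ ∃ (T : R) (b : ob T ⟶ E), IsMeshKernel ρ b g

theorem RightAlmostSplit.of_isIso {E E' V : C} {g : E ⟶ V} (hg : RightAlmostSplit ρ g)
    (θ : E' ⟶ E) [IsIso θ] : RightAlmostSplit ρ (θ ≫ g) :=
  ⟨ρ.comp_mem_right _ hg.1, fun M r hr => by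
    obtain ⟨t, ht⟩ := hg.2 M r hr
    exact ⟨t ≫ inv θ, by simp [ht]⟩⟩

theorem exists_sink [∀ X Y : C, FiniteDimensional k (X ⟶ Y)] (hs : IsSkeletal ob)
    (hP : ∀ M : C, ∃ (S : NakayamaPair k C) (π : S.P ⟶ M), Epi π)
    {I : ∀ W V : R, Submodule k (ob W ⟶ ob V)} (hI : Good ρ I) (V : R) :
    Nonempty (Sink ρ I V) := by
  obtain ⟨E, g, hg, hmesh⟩ := exists_almostSplit ρ hP (hs.noIdem V) hs.exists_iso
  obtain ⟨d⟩ := Decomp.exists_decomp k hs.exists_iso E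
  have h1 : ∀ a, ∃ r ∈ ρ.pow 1 (ob (d.s a)) E, d.q a ≫ g - r ≫ g ∈ I (d.s a) V := by
    intro a
    obtain ⟨α, hα, δ, hδ, h⟩ := Submodule.mem_sup.1 (hI.le_sup (d.s a) V
      (ρ.comp_mem_right (d.q a) hg.1))
    obtain ⟨r, hr, rfl⟩ := hg.exists_lift 1 hδ
    exact ⟨r, hr, by rwa [← h, add_sub_cancel_right]⟩
  choose r hr hrI using h1
  set θ : E ⟶ E := 𝟙 E - ∑ a, d.p a ≫ r a with hθ
  have hiso : IsIso θ := by
    have h2 := (ρ.mem_one (∑ a, d.p a ≫ r a)).1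
      ((ρ.pow 1 E E).sum_mem fun a _ => ρ.comp_mem_right _ (hr a)) (𝟙 E)
    rwa [Category.comp_id] at h2
  have hqθ : ∀ a, d.q a ≫ θ = d.q a - r a := fun a => by
    rw [hθ, Preadditive.comp_sub, Category.comp_id, Preadditive.comp_sum,
      Finset.sum_eq_single a]
    · rw [← Category.assoc, d.qp_self, Category.id_comp]
    · intro b _ hb
      rw [← Category.assoc, d.qp_ne a b hb.symm, Limits.zero_comp]
    · simp
  refine ⟨⟨E, θ ≫ g, d, hg.of_isIso θ, fun a => ?_, ?_⟩⟩
  · rw [← Category.assoc, hqθ, Preadditive.sub_comp]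
    exact hrI a
  · rcases hmesh with h | ⟨T, b, hb⟩
    · exact Or.inl inferInstance
    · exact Or.inr ⟨T, _, hb.of_iso (Iso.refl _) (asIso θ).symm⟩

/-- Elements of the complements are scalar combinations of the components of a sink. -/
theorem Sink.exists_scal [IsAlgClosed k] [∀ X Y : C, FiniteDimensional k (X ⟶ Y)]
    (hs : IsSkeletal ob) {I : ∀ W V : R, Submodule k (ob W ⟶ ob V)} (hI : Good ρ I) {V : R}
    (S : Sink ρ I V) {W : R} {φ : ob W ⟶ ob V} (hφ : φ ∈ I W V) :
    ∃ c : S.d.ι → k, φ = (∑ a, scal ob (c a) W (S.d.s a) ≫ S.d.q a) ≫ S.g := by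
  obtain ⟨t, ht⟩ := S.ras.2 _ _ (hI.le _ _ hφ)
  choose c hc using fun a => hs.exists_scal (ρ := ρ) (t ≫ S.d.p a)
  refine ⟨c, ?_⟩
  rw [← sub_eq_zero]
  refine hI.eq_zero W V _ ?_ ?_
  · refine (I W V).sub_mem hφ ?_
    rw [Preadditive.sum_comp]
    refine (I W V).sum_mem fun a _ => ?_
    rw [Category.assoc]
    exact scal_comp_mem (fun W => I W V) _ _ _ (S.mem a)
  · rw [← ht, S.d.comp_eq_sum, Preadditive.sum_comp, ← Finset.sum_sub_distrib]
    refine (ρ.pow 2 _ _).sum_mem fun a _ => ?_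
    rw [Category.assoc (scal ob (c a) W _), ← Preadditive.sub_comp]
    exact ρ.comp_mem 1 1 (hc a) (ρ.comp_mem_right _ S.ras.1)

theorem IsMeshKernel.eq_of_same_source [∀ X Y : C, FiniteDimensional k (X ⟶ Y)]
    (hs : IsSkeletal ob) {T V₁ V₂ : R} {E₁ E₂ : C} {g₁ : E₁ ⟶ ob V₁} {g₂ : E₂ ⟶ ob V₂}
    {b₁ : ob T ⟶ E₁} {b₂ : ob T ⟶ E₂} (hg₁ : g₁ ∈ ρ.pow 1 E₁ (ob V₁))
    (hg₂ : RightAlmostSplit ρ g₂)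
    (h₁ : IsMeshKernel ρ b₁ g₁) (h₂ : IsMeshKernel ρ b₂ g₂) : V₁ = V₂ := by
  obtain ⟨t, ht⟩ := h₁.fact _ _ h₂.mem
  obtain ⟨s, hst⟩ := h₂.fact _ _ h₁.mem
  obtain ⟨z, hz⟩ := h₁.desc _ (t ≫ g₂) (by rw [← Category.assoc, ht, h₂.comp_eq_zero])
  by_contra hne
  obtain ⟨u, hu⟩ := hg₂.2 _ z (ρ.mem_one_of_not_isIso (hs.noIdem _) (hs.noIdem _)
    fun _ => hne (hs.eq_of_iso _ _ ⟨asIso z⟩))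
  obtain ⟨y, hy⟩ := h₂.desc _ (𝟙 _ - s ≫ t) (by
    rw [Preadditive.comp_sub, ← Category.assoc, hst, ht, Category.comp_id, sub_self])
  have h3 : 𝟙 E₂ - (g₂ ≫ y + s ≫ g₁ ≫ u) = s ≫ t - s ≫ g₁ ≫ u := by
    rw [hy]; abel
  have h4 : g₂ ≫ y + s ≫ g₁ ≫ u ∈ ρ.pow 1 E₂ E₂ :=
    (ρ.pow 1 _ _).add_mem (ρ.comp_mem_left _ hg₂.1)
      (ρ.comp_mem_right _ (ρ.comp_mem_left _ hg₁))
  have h5 := (ρ.mem_one _).1 h4 (𝟙 _)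
  rw [Category.comp_id, h3] at h5
  have h6 : (s ≫ t - s ≫ g₁ ≫ u) ≫ g₂ = 0 := by
    rw [Preadditive.sub_comp]
    simp only [Category.assoc]
    rw [hu, hz, sub_self]
  have h7 : g₂ = 0 := by
    rw [← cancel_epi (s ≫ t - s ≫ g₁ ≫ u), h6, Limits.comp_zero]
  obtain ⟨w, hw⟩ := h₂.lift _ (𝟙 E₂) (by rw [h7, Limits.comp_zero])
  have h8 : 𝟙 E₂ = 0 := ρ.id_eq_zero (by
    rw [← hw]
    exact ρ.comp_mem_right _ h₂.mem)
  have := h₂.mono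
  apply (hs.noIdem T).1
  rw [← cancel_mono b₂, ← Category.comp_id (𝟙 _ ≫ b₂), h8]
  simp

/-- The morphisms out of a decomposed object all of whose components are scalar. -/
noncomputable def scalarMaps {E : C} (d : Decomp ob E) (U : R) : Submodule k (E ⟶ ob U) where
  carrier := {t | ∀ a, ∃ c : k, d.q a ≫ t = scal ob c (d.s a) U}
  add_mem' := by
    intro t t' ht ht' a
    obtain ⟨c, hc⟩ := ht a
    obtain ⟨c', hc'⟩ := ht' a
    exact ⟨c + c', by rw [Preadditive.comp_add, hc, hc', scal_add]⟩
  zero_mem' := fun a => ⟨0, by rw [Limits.comp_zero, scal_zero]⟩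
  smul_mem' := by
    intro c t ht a
    obtain ⟨c', hc'⟩ := ht a
    exact ⟨c * c', by rw [Linear.comp_smul, hc', smul_scal]⟩

theorem p_mem_scalarMaps {E : C} (d : Decomp ob E) (a : d.ι) :
    d.p a ∈ scalarMaps (k := k) d (d.s a) := by
  intro b
  by_cases h : b = a
  · subst h
    exact ⟨1, by simp [d.qp_self, scal]⟩
  · exact ⟨0, by rw [d.qp_ne b a h, scal_zero]⟩

theorem IsSkeletal.eq_zero_of_mem_scalarMaps (hs : IsSkeletal ob) {E : C} (d : Decomp ob E)
    {U : R} {t : E ⟶ ob U} (ht : t ∈ scalarMaps (k := k) d U) (ht' : t ∈ ρ.pow 1 E (ob U)) :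
    t = 0 := by
  rw [← Category.id_comp t, d.comp_eq_sum]
  refine Finset.sum_eq_zero fun a _ => ?_
  obtain ⟨c, hc⟩ := ht a
  rw [hc, hs.scal_eq_zero (ρ := ρ) (by rw [← hc]; exact ρ.comp_mem_right _ ht'), Limits.comp_zero]

/-- Complements of the square of the radical, adapted to the almost split sequences ending in the
sinks of another choice of complements. -/
theorem exists_next [∀ X Y : C, FiniteDimensional k (X ⟶ Y)] (hs : IsSkeletal ob)
    {I : ∀ W V : R, Submodule k (ob W ⟶ ob V)} (S : ∀ V, Sink ρ I V) :
    ∃ I' : ∀ W V : R, Submodule k (ob W ⟶ ob V), Good ρ I' ∧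
      ∀ V, Mono (S V).g ∨ ∃ (T : R) (b : ob T ⟶ (S V).E), IsMeshKernel ρ b (S V).g ∧
        ∀ a, b ≫ (S V).d.p a ∈ I' T ((S V).d.s a) := by
  have h0 : ∀ V, ∃ m : Σ T : R, (ob T ⟶ (S V).E),
      ¬ Mono (S V).g → IsMeshKernel ρ m.2 (S V).g := fun V => by
    rcases (S V).mesh with h | ⟨T, b, hb⟩
    · exact ⟨⟨V, 0⟩, fun hh => absurd h hh⟩
    · exact ⟨⟨T, b⟩, fun _ => hb⟩
  choose m hm using h0
  have key : ∀ T U : R, ∃ J : Submodule k (ob T ⟶ ob U),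
      (∀ V, ¬ Mono (S V).g → ∀ b, m V = ⟨T, b⟩ → ∀ t ∈ scalarMaps (k := k) (S V).d U,
        b ≫ t ∈ J) ∧
      J ≤ ρ.pow 1 _ _ ∧ (∀ x ∈ J, x ∈ ρ.pow 2 _ _ → x = 0) ∧
      ρ.pow 1 _ _ ≤ J ⊔ ρ.pow 2 _ _ := by
    intro T U
    by_cases h : ∃ V, ¬ Mono (S V).g ∧ ∃ b, m V = ⟨T, b⟩
    · obtain ⟨V, hV, b, hb⟩ := h
      have hmk : IsMeshKernel ρ b (S V).g := by
        have := hm V hV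
        rwa [hb] at this
      obtain ⟨J, hJ, hJ'⟩ := ρ.exists_complement
        ((scalarMaps (k := k) (S V).d U).map (Linear.leftComp k (ob U) b)) (by
          rintro _ ⟨t, -, rfl⟩
          exact ρ.comp_mem_left _ hmk.mem) (by
          rintro _ ⟨t, ht, rfl⟩ hx
          obtain ⟨y, hy, hyt⟩ := hmk.exists_extension hx
          rw [Linear.leftComp_apply] at hyt ⊢
          obtain ⟨s, hs'⟩ := hmk.desc _ (t - y) (by rw [Preadditive.comp_sub, hyt, sub_self])
          rw [hs.eq_zero_of_mem_scalarMaps (ρ := ρ) _ ht, Limits.comp_zero]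
          rw [sub_eq_iff_eq_add.1 hs'.symm]
          exact (ρ.pow 1 _ _).add_mem (ρ.comp_mem_left _ (S V).ras.1) hy)
      refine ⟨J, fun V' hV' b' hb' t ht => ?_, hJ'⟩
      have hmk' : IsMeshKernel ρ b' (S V').g := by
        have := hm V' hV'
        rwa [hb'] at this
      obtain rfl := hmk.eq_of_same_source hs (S V).ras.1 (S V').ras hmk'
      obtain rfl : b = b' := eq_of_heq (Sigma.mk.inj (hb.symm.trans hb')).2
      exact hJ ⟨t, ht, rfl⟩
    · obtain ⟨J, -, hJ⟩ := ρ.exists_complement (X := ob T) (Y := ob U) ⊥ bot_le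
        fun x hx _ => (Submodule.mem_bot k).1 hx
      exact ⟨J, fun V hV b hb => absurd ⟨V, hV, b, hb⟩ h, hJ⟩
  choose I' h1 h2 h3 h4 using key
  refine ⟨I', ⟨h2, h3, h4⟩, fun V => ?_⟩
  rw [or_iff_not_imp_left]
  exact fun hV => ⟨(m V).1, (m V).2, hm V hV,
    fun a => h1 _ _ V hV _ rfl _ (p_mem_scalarMaps _ a)⟩

end Sinks

section Layers

variable {k : Type*} [Field k] {C : Type*} [Category C] [Abelian C] [Linear k C]
variable {R : Type*} {ob : R → C}

/-- A sequence of complements, each one adapted to the almost split sequences of the previous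
one. -/
structure IsTower (ρ : RadFiltration k C)
    (I : ℕ → ∀ W V : R, Submodule k (ob W ⟶ ob V)) : Prop where
  good : ∀ l, Good ρ (I l)
  link : ∀ l V, ∃ S : Sink ρ (I l) V, Mono S.g ∨ ∃ (T : R) (b : ob T ⟶ S.E),
    IsMeshKernel ρ b S.g ∧ ∀ a, b ≫ S.d.p a ∈ I (l + 1) T (S.d.s a)

theorem exists_tower [∀ X Y : C, FiniteDimensional k (X ⟶ Y)] {ρ : RadFiltration k C}
    (hs : IsSkeletal ob) (hP : ∀ M : C, ∃ (S : NakayamaPair k C) (π : S.P ⟶ M), Epi π)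
    {J : ∀ W V : R, Submodule k (ob W ⟶ ob V)} (hJ : Good ρ J) :
    ∃ I : ℕ → ∀ W V : R, Submodule k (ob W ⟶ ob V), I 0 = J ∧ IsTower ρ I := by
  let step : {I : ∀ W V : R, Submodule k (ob W ⟶ ob V) // Good ρ I} →
      {I : ∀ W V : R, Submodule k (ob W ⟶ ob V) // Good ρ I} := fun I =>
    ⟨_, (exists_next hs fun V => (exists_sink hs hP I.2 V).some).choose_spec.1⟩
  refine ⟨fun l => (step^[l] ⟨J, hJ⟩).1, rfl, fun l => (step^[l] ⟨J, hJ⟩).2, fun l V => ?_⟩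
  rw [Function.iterate_succ_apply']
  exact ⟨_, (exists_next hs fun V =>
    (exists_sink hs hP (step^[l] ⟨J, hJ⟩).2 V).some).choose_spec.2 V⟩

/-- The span of the paths of length `m` ending in `V`, starting from a complement of the
radical. -/
noncomputable def layer (ρ : RadFiltration k C)
    (I : ℕ → ∀ W V : R, Submodule k (ob W ⟶ ob V)) (Z : C) :
    ℕ → ℕ → ∀ V : R, Submodule k (Z ⟶ ob V)
  | 0, _, V => (Submodule.exists_isCompl (ρ.pow 1 Z (ob V))).choose
  | m + 1, l, V => Submodule.span k {x | ∃ (W : R) (y : Z ⟶ ob W) (φ : ob W ⟶ ob V),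
      y ∈ layer ρ I Z m (l + 1) W ∧ φ ∈ I l W V ∧ x = y ≫ φ}

variable {ρ : RadFiltration k C} {I : ℕ → ∀ W V : R, Submodule k (ob W ⟶ ob V)} {Z : C}

theorem layer_zero_isCompl (l : ℕ) (V : R) :
    IsCompl (ρ.pow 1 Z (ob V)) (layer ρ I Z 0 l V) :=
  (Submodule.exists_isCompl (ρ.pow 1 Z (ob V))).choose_spec

theorem comp_mem_layer {m l : ℕ} {W V : R} {y : Z ⟶ ob W} {φ : ob W ⟶ ob V}
    (hy : y ∈ layer ρ I Z m (l + 1) W) (hφ : φ ∈ I l W V) : y ≫ φ ∈ layer ρ I Z (m + 1) l V :=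
  Submodule.subset_span ⟨W, y, φ, hy, hφ, rfl⟩

theorem layer_le (hI : ∀ l, Good ρ (I l)) (m l : ℕ) (V : R) :
    layer ρ I Z m l V ≤ ρ.pow m Z (ob V) := by
  induction m generalizing l V with
  | zero => rw [ρ.pow_zero]; exact le_top
  | succ m ih =>
    refine Submodule.span_le.2 ?_
    rintro _ ⟨W, y, φ, hy, hφ, rfl⟩
    exact ρ.comp_mem m 1 (ih _ _ hy) ((hI l).le _ _ hφ)

theorem le_layer_sup (hI : IsTower ρ I) (m l : ℕ) (V : R) :
    ρ.pow m Z (ob V) ≤ layer ρ I Z m l V ⊔ ρ.pow (m + 1) Z (ob V) := by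
  induction m generalizing l V with
  | zero =>
    rw [sup_comm, (layer_zero_isCompl l V).sup_eq_top]
    exact le_top
  | succ m ih =>
    obtain ⟨S, -⟩ := hI.link l V
    intro x hx
    obtain ⟨y, hy, rfl⟩ := S.ras.exists_lift m hx
    rw [S.d.comp_eq_sum]
    refine Submodule.sum_mem _ fun a _ => ?_
    obtain ⟨h, hh, z, hz, hyz⟩ := Submodule.mem_sup.1 (ih (l + 1) (S.d.s a)
      (ρ.comp_mem_left (S.d.p a) hy))
    rw [← hyz, Preadditive.add_comp]
    exact Submodule.add_mem_sup (comp_mem_layer hh (S.mem a))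
      (ρ.comp_mem (m + 1) 1 hz (ρ.comp_mem_right _ S.ras.1))

theorem exists_of_mem_layer_succ [IsAlgClosed k] [∀ X Y : C, FiniteDimensional k (X ⟶ Y)]
    (hs : IsSkeletal ob) (hI : ∀ l, Good ρ (I l)) {m l : ℕ} {V : R} (S : Sink ρ (I l) V)
    {x : Z ⟶ ob V} (hx : x ∈ layer ρ I Z (m + 1) l V) :
    ∃ u : Z ⟶ S.E, (∀ a, u ≫ S.d.p a ∈ layer ρ I Z m (l + 1) (S.d.s a)) ∧ u ≫ S.g = x := by
  let L : Submodule k (Z ⟶ S.E) :=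
    ⨅ a, (layer ρ I Z m (l + 1) (S.d.s a)).comap (Linear.rightComp k Z (S.d.p a))
  suffices h : layer ρ I Z (m + 1) l V ≤ L.map (Linear.rightComp k Z S.g) by
    obtain ⟨u, hu, rfl⟩ := h hx
    exact ⟨u, fun a => (Submodule.mem_iInf _).1 hu a, rfl⟩
  refine Submodule.span_le.2 ?_
  rintro _ ⟨W, y, φ, hy, hφ, rfl⟩
  obtain ⟨c, rfl⟩ := S.exists_scal hs (hI l) hφ
  refine ⟨y ≫ ∑ a, scal ob (c a) W (S.d.s a) ≫ S.d.q a, (Submodule.mem_iInf _).2 fun a => ?_,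
    Category.assoc _ _ _⟩
  rw [Submodule.mem_comap, Linear.rightComp_apply, Category.assoc, Preadditive.sum_comp,
    Finset.sum_eq_single a]
  · rw [Category.assoc, S.d.qp_self, Category.comp_id]
    exact comp_scal_mem (fun W => layer ρ I Z m (l + 1) W) _ _ _ hy
  · intro b _ hb
    rw [Category.assoc, S.d.qp_ne b a hb, Limits.comp_zero]
  · simp

theorem Decomp.eq_zero_of_forall {C : Type*} [Category C] [Preadditive C] {R : Type*} {ob : R → C}
    {X Y : C} (d : Decomp ob Y) {x : X ⟶ Y} (h : ∀ a, x ≫ d.p a = 0) : x = 0 := by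
  rw [← Category.comp_id x, d.comp_eq_sum]
  exact Finset.sum_eq_zero fun a _ => by rw [h, Limits.zero_comp]

theorem eq_zero_of_mem_layer [IsAlgClosed k] [∀ X Y : C, FiniteDimensional k (X ⟶ Y)]
    (hs : IsSkeletal ob) (hI : IsTower ρ I) (m l : ℕ) (V : R) {x : Z ⟶ ob V}
    (hx : x ∈ layer ρ I Z m l V) (hx' : x ∈ ρ.pow (m + 1) Z (ob V)) : x = 0 := by
  induction m using Nat.strong_induction_on generalizing l V with
  | _ m ih =>
  rcases m with _ | m
  · exact Submodule.disjoint_def.1 (layer_zero_isCompl (I := I) l V).disjoint x hx' hx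
  obtain ⟨S, hS⟩ := hI.link l V
  obtain ⟨u, hu, rfl⟩ := exists_of_mem_layer_succ hs hI.good S hx
  obtain ⟨u', hu', huu⟩ := S.ras.exists_lift (m + 1) hx'
  have h0 : (u - u') ≫ S.g = 0 := by rw [Preadditive.sub_comp, huu, sub_self]
  have ihm := ih m (Nat.lt_succ_self m)
  rcases hS with hmono | ⟨T, b, hb, hbI⟩
  · have h1 : u = u' := (cancel_mono S.g).1 huu.symm
    rw [S.d.eq_zero_of_forall fun a =>
      ihm _ _ (hu a) (by rw [h1]; exact ρ.comp_mem_left _ hu'), Limits.zero_comp]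
  obtain ⟨w, hw⟩ := hb.lift _ _ h0
  have hu₁ : u = w ≫ b + u' := by rw [hw, sub_add_cancel]
  rcases m with _ | m
  · rw [S.d.eq_zero_of_forall fun a => ihm _ _ (hu a) ?_, Limits.zero_comp]
    rw [hu₁]
    exact ρ.comp_mem_left _ ((ρ.pow 1 _ _).add_mem (ρ.comp_mem_right _ hb.mem) hu')
  have hmono := hb.mono
  have hstep : ∀ j ≤ m, w ∈ ρ.pow j Z (ob T) := by
    intro j
    induction j with
    | zero => intro _; rw [ρ.pow_zero]; trivial
    | succ j ihj =>
      intro hj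
      obtain ⟨y, hy, w', hw', hyw⟩ := Submodule.mem_sup.1
        (le_layer_sup hI j (l + 2) T (ihj (by omega)))
      have hy0 : y ≫ b = 0 := S.d.eq_zero_of_forall fun a => by
        rw [Category.assoc]
        refine ih (j + 1) (by omega) (l + 1) _ (comp_mem_layer hy (hbI a)) ?_
        have h2 : y ≫ b = u - u' - w' ≫ b := by
          rw [hu₁, ← hyw, Preadditive.add_comp]
          abel
        rw [← Category.assoc, h2, Preadditive.sub_comp, Preadditive.sub_comp]
        refine (ρ.pow (j + 1 + 1) _ _).sub_mem ((ρ.pow (j + 1 + 1) _ _).sub_mem ?_ ?_) ?_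
        · exact ρ.antitone _ _ (by omega : j + 1 + 1 ≤ m + 1) (layer_le hI.good _ _ _ (hu a))
        · exact ρ.antitone _ _ (by omega : j + 1 + 1 ≤ m + 1 + 1) (ρ.comp_mem_left _ hu')
        · exact ρ.comp_mem_left _ (ρ.comp_mem (j + 1) 1 hw' hb.mem)
      have hy1 : y = 0 := (cancel_mono b).1 (by rw [hy0, Limits.zero_comp])
      rw [← hyw, hy1, zero_add]
      exact hw'
  obtain ⟨y, hy, w', hw', hyw⟩ := Submodule.mem_sup.1 (le_layer_sup hI m (l + 2) T (hstep m le_rfl))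
  have h3 : u - y ≫ b = 0 := S.d.eq_zero_of_forall fun a => by
    refine ihm (l + 1) _ ?_ ?_
    · rw [Preadditive.sub_comp, Category.assoc]
      exact Submodule.sub_mem _ (hu a) (comp_mem_layer hy (hbI a))
    · have h4 : u - y ≫ b = u' + w' ≫ b := by
        rw [hu₁, ← hyw, Preadditive.add_comp]
        abel
      rw [h4]
      exact ρ.comp_mem_left _ (Submodule.add_mem _ hu' (ρ.comp_mem (m + 1) 1 hw' hb.mem))
  rw [sub_eq_zero.1 h3, Category.assoc, hb.comp_eq_zero, Limits.comp_zero]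

end Layers

section Irreducible

variable {k : Type*} [Field k]

/-- Irreducible morphisms of an abelian category. -/
def IsIrr {C : Type*} [Category C] {X Y : C} (f : X ⟶ Y) : Prop :=
  ¬ IsSplitMono f ∧ ¬ IsSplitEpi f ∧
    ∀ (Z : C) (g : X ⟶ Z) (h : Z ⟶ Y), g ≫ h = f → IsSplitMono g ∨ IsSplitEpi h

/-- Two objects are isomorphic, or have no nontrivial idempotents and are joined by an irreducible
morphism. -/
def IrrStep {C : Type*} [Category C] [Preadditive C] (X Y : C) : Prop :=
  (NoIdem X ∧ NoIdem Y ∧ ((∃ f : X ⟶ Y, IsIrr f) ∨ (∃ f : Y ⟶ X, IsIrr f))) ∨ Nonempty (X ≅ Y)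

theorem exists_isSkeletal.{u, v} (C : Type u) [Category.{v} C] [Abelian C] :
    ∃ (R : Type u) (ob : R → C), IsSkeletal ob := by
  let s : Setoid {X : C // NoIdem X} :=
    { r := fun X Y => Nonempty (X.1 ≅ Y.1)
      iseqv := ⟨fun X => ⟨Iso.refl _⟩, fun ⟨e⟩ => ⟨e.symm⟩, fun ⟨e⟩ ⟨e'⟩ => ⟨e ≪≫ e'⟩⟩ }
  refine ⟨Quotient s, fun q => (Quotient.out q).1, fun q => (Quotient.out q).2,
    fun V hV => ⟨Quotient.mk s ⟨V, hV⟩, ?_⟩, fun r t h => ?_⟩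
  · exact s.symm' (Quotient.mk_out (s := s) ⟨V, hV⟩)
  · rw [← Quotient.out_eq r, ← Quotient.out_eq t]
    exact Quotient.sound h

variable {C : Type*} [Category C] [Abelian C] [Linear k C] {ρ : RadFiltration k C}
variable {R : Type*} {ob : R → C}

/-- The morphisms into a decomposed object all of whose components are scalar. -/
noncomputable def scalarMapsTo {E : C} (d : Decomp ob E) (W : R) : Submodule k (ob W ⟶ E) where
  carrier := {t | ∀ a, ∃ c : k, t ≫ d.p a = scal ob c W (d.s a)}
  add_mem' := by
    intro t t' ht ht' a
    obtain ⟨c, hc⟩ := ht a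
    obtain ⟨c', hc'⟩ := ht' a
    exact ⟨c + c', by rw [Preadditive.add_comp, hc, hc', scal_add]⟩
  zero_mem' := fun a => ⟨0, by rw [Limits.zero_comp, scal_zero]⟩
  smul_mem' := by
    intro c t ht a
    obtain ⟨c', hc'⟩ := ht a
    exact ⟨c * c', by rw [Linear.smul_comp, hc', smul_scal]⟩

theorem q_mem_scalarMapsTo {E : C} (d : Decomp ob E) (a : d.ι) :
    d.q a ∈ scalarMapsTo (k := k) d (d.s a) := by
  intro b
  by_cases h : a = b
  · subst h
    exact ⟨1, by simp [d.qp_self, scal]⟩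
  · exact ⟨0, by rw [d.qp_ne a b h, scal_zero]⟩

theorem IsSkeletal.eq_zero_of_mem_scalarMapsTo (hs : IsSkeletal ob) {E : C} (d : Decomp ob E)
    {W : R} {t : ob W ⟶ E} (ht : t ∈ scalarMapsTo (k := k) d W)
    (ht' : t ∈ ρ.pow 1 (ob W) E) : t = 0 := by
  refine d.eq_zero_of_forall fun a => ?_
  obtain ⟨c, hc⟩ := ht a
  rw [hc, hs.scal_eq_zero (ρ := ρ) (by rw [← hc]; exact ρ.comp_mem_left _ ht')]

variable [∀ X Y : C, FiniteDimensional k (X ⟶ Y)]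

theorem RadFiltration.isIrr (ρ : RadFiltration k C) {X Y : C} (hX : NoIdem X) (hY : NoIdem Y)
    {f : X ⟶ Y} (h1 : f ∈ ρ.pow 1 X Y) (h2 : f ∉ ρ.pow 2 X Y) : IsIrr f := by
  refine ⟨ρ.not_isSplitMono h1 hX.1, ρ.not_isSplitEpi h1 hY.1, fun Z g h hgh => ?_⟩
  by_contra! hc
  exact h2 (hgh ▸ ρ.comp_mem 1 1 (ρ.mem_one_of_not_isSplitMono hX hc.1)
    (ρ.mem_one_of_not_isSplitEpi hY hc.2))

theorem IsIrr.comp_splitEpi_notMem {X Y V : C} {f : X ⟶ Y} (hf : IsIrr f) (hX : NoIdem X)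
    (hV : NoIdem V) (hP : ∀ M : C, ∃ (S : NakayamaPair k C) (π : S.P ⟶ M), Epi π)
    {q : V ⟶ Y} {p : Y ⟶ V} (hqp : q ≫ p = 𝟙 V) : f ≫ p ∉ ρ.pow 2 X V := by
  intro h
  obtain ⟨E, g, hg⟩ := exists_rightAlmostSplit ρ hP hV
  obtain ⟨r, hr, hrg⟩ := hg.exists_lift 1 h
  have hf1 := ρ.mem_one_of_not_isSplitMono hX hf.1
  rcases hf.2.2 (Y ⊞ E) (Limits.biprod.lift (f ≫ (𝟙 Y - p ≫ q)) r)
    (Limits.biprod.desc (𝟙 Y - p ≫ q) (g ≫ q)) (by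
      rw [Limits.biprod.lift_desc, ← Category.assoc r, hrg]
      simp [Preadditive.sub_comp, Preadditive.comp_sub, reassoc_of% hqp]) with h1 | h1
  · refine ρ.not_isSplitMono ?_ hX.1 h1
    rw [Limits.biprod.lift_eq]
    exact Submodule.add_mem _ (ρ.comp_mem_left _ (ρ.comp_mem_left _ hf1)) (ρ.comp_mem_left _ hr)
  · obtain ⟨⟨s, hs⟩⟩ := h1.exists_splitEpi
    have h2 := congrArg (fun t => t ≫ p) hs
    rw [Limits.biprod.desc_eq] at h2
    simp only [Preadditive.comp_add, Preadditive.add_comp, Preadditive.sub_comp, Category.assoc,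
      hqp, Category.id_comp, Category.comp_id, sub_self, Limits.comp_zero, zero_add] at h2
    refine ρ.not_isSplitEpi ?_ hV.1 (IsSplitEpi.mk' ⟨q, hqp⟩)
    rw [← h2]
    exact ρ.comp_mem_right _ (ρ.comp_mem_right _ hg.1)

theorem IsIrr.splitMono_comp_notMem {X Y W : C} {f : X ⟶ Y} (hf : IsIrr f) (hY : NoIdem Y)
    (hW : 𝟙 W ≠ 0) (hP : ∀ M : C, ∃ (S : NakayamaPair k C) (π : S.P ⟶ M), Epi π)
    {q : W ⟶ X} {p : X ⟶ W} (hqp : q ≫ p = 𝟙 W) : q ≫ f ∉ ρ.pow 2 W Y := by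
  intro h
  obtain ⟨E, g, hg⟩ := exists_rightAlmostSplit ρ hP hY
  obtain ⟨r, hr, hrg⟩ := hg.exists_lift 1 h
  have hf1 := ρ.mem_one_of_not_isSplitEpi hY hf.2.1
  rcases hf.2.2 (X ⊞ E) (Limits.biprod.lift (𝟙 X - p ≫ q) (p ≫ r))
    (Limits.biprod.desc ((𝟙 X - p ≫ q) ≫ f) g) (by
      rw [Limits.biprod.lift_desc, Category.assoc p, hrg]
      simp [Preadditive.sub_comp, Preadditive.comp_sub, reassoc_of% hqp]) with h1 | h1
  · obtain ⟨⟨s, hs⟩⟩ := h1.exists_splitMono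
    have h2 := congrArg (fun t => q ≫ t) hs
    rw [Limits.biprod.lift_eq] at h2
    simp only [Preadditive.comp_add, Preadditive.add_comp, Preadditive.sub_comp,
      Preadditive.comp_sub, Category.assoc,
      reassoc_of% hqp, Category.id_comp, Category.comp_id, sub_self, zero_add] at h2
    refine ρ.not_isSplitMono ?_ hW (IsSplitMono.mk' ⟨p, hqp⟩)
    rw [← h2]
    exact ρ.comp_mem_left _ hr
  · refine ρ.not_isSplitEpi ?_ hY.1 h1
    rw [Limits.biprod.desc_eq]
    exact Submodule.add_mem _ (ρ.comp_mem_right _ (ρ.comp_mem_right _ hf1))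
      (ρ.comp_mem_right _ hg.1)

theorem IsIrr.exists_good_source {X Y : C} {f : X ⟶ Y} (hf : IsIrr f) (hs : IsSkeletal ob)
    (hX : NoIdem X) (hP : ∀ M : C, ∃ (S : NakayamaPair k C) (π : S.P ⟶ M), Epi π)
    (dY : Decomp ob Y) :
    ∃ (dX : Decomp ob X) (J : ∀ W V : R, Submodule k (ob W ⟶ ob V)), Good ρ J ∧
      ∀ i j, dX.q i ≫ f ≫ dY.p j ∈ J (dX.s i) (dY.s j) := by
  obtain ⟨r, ⟨φ⟩⟩ := hs.exists_iso X hX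
  have key : ∀ W V : R, ∃ J : Submodule k (ob W ⟶ ob V),
      (∀ e : W = r, ∀ t ∈ scalarMaps (k := k) dY V,
        eqToHom (congrArg ob e) ≫ φ.inv ≫ f ≫ t ∈ J) ∧
      J ≤ ρ.pow 1 _ _ ∧ (∀ x ∈ J, x ∈ ρ.pow 2 _ _ → x = 0) ∧
      ρ.pow 1 _ _ ≤ J ⊔ ρ.pow 2 _ _ := by
    intro W V
    by_cases e : W = r
    · subst e
      obtain ⟨J, hJ, hJ'⟩ := ρ.exists_complement
        ((scalarMaps (k := k) dY V).map (Linear.leftComp k (ob V) (φ.inv ≫ f))) (by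
          rintro _ ⟨t, -, rfl⟩
          exact ρ.comp_mem_left _
            (ρ.comp_mem_right _ (ρ.mem_one_of_not_isSplitMono hX hf.1))) (by
          rintro _ ⟨t, ht, rfl⟩ hx
          rw [Linear.leftComp_apply] at hx ⊢
          suffices h : t ∈ ρ.pow 1 _ _ by
            rw [hs.eq_zero_of_mem_scalarMaps dY ht h, Limits.comp_zero]
          refine ρ.mem_one_of_not_isSplitEpi (hs.noIdem V) fun h => ?_
          refine hf.comp_splitEpi_notMem (ρ := ρ) hX (hs.noIdem V) hP (IsSplitEpi.id t) ?_
          simpa using ρ.comp_mem_right φ.hom hx)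
      exact ⟨J, fun e t ht => hJ ⟨t, ht, by simp⟩, hJ'⟩
    · obtain ⟨J, -, hJ⟩ := ρ.exists_complement (X := ob W) (Y := ob V) ⊥ bot_le
        fun x hx _ => (Submodule.mem_bot k).1 hx
      exact ⟨J, fun e' => absurd e' e, hJ⟩
  choose J h1 h2 h3 h4 using key
  refine ⟨⟨Unit, fun _ => r, fun _ => φ.hom, fun _ => φ.inv, by simp,
    fun i j h => absurd rfl h, by simp⟩, J, ⟨h2, h3, h4⟩, fun i j => ?_⟩
  simpa using h1 r (dY.s j) rfl _ (p_mem_scalarMaps dY j)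

theorem IsIrr.exists_good_target {X Y : C} {f : X ⟶ Y} (hf : IsIrr f) (hs : IsSkeletal ob)
    (hY : NoIdem Y) (hP : ∀ M : C, ∃ (S : NakayamaPair k C) (π : S.P ⟶ M), Epi π)
    (dX : Decomp ob X) :
    ∃ (dY : Decomp ob Y) (J : ∀ W V : R, Submodule k (ob W ⟶ ob V)), Good ρ J ∧
      ∀ i j, dX.q i ≫ f ≫ dY.p j ∈ J (dX.s i) (dY.s j) := by
  obtain ⟨r, ⟨φ⟩⟩ := hs.exists_iso Y hY
  have key : ∀ W V : R, ∃ J : Submodule k (ob W ⟶ ob V),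
      (∀ e : r = V, ∀ t ∈ scalarMapsTo (k := k) dX W,
        (t ≫ f ≫ φ.hom) ≫ eqToHom (congrArg ob e) ∈ J) ∧
      J ≤ ρ.pow 1 _ _ ∧ (∀ x ∈ J, x ∈ ρ.pow 2 _ _ → x = 0) ∧
      ρ.pow 1 _ _ ≤ J ⊔ ρ.pow 2 _ _ := by
    intro W V
    by_cases e : r = V
    · subst e
      obtain ⟨J, hJ, hJ'⟩ := ρ.exists_complement
        ((scalarMapsTo (k := k) dX W).map (Linear.rightComp k (ob W) (f ≫ φ.hom))) (by
          rintro _ ⟨t, -, rfl⟩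
          exact ρ.comp_mem_right _
            (ρ.comp_mem_left _ (ρ.mem_one_of_not_isSplitEpi hY hf.2.1))) (by
          rintro _ ⟨t, ht, rfl⟩ hx
          rw [Linear.rightComp_apply] at hx ⊢
          suffices h : t ∈ ρ.pow 1 _ _ by
            rw [hs.eq_zero_of_mem_scalarMapsTo dX ht h, Limits.zero_comp]
          refine ρ.mem_one_of_not_isSplitMono (hs.noIdem W) fun h => ?_
          refine hf.splitMono_comp_notMem (ρ := ρ) hY (hs.noIdem W).1 hP (IsSplitMono.id t) ?_
          simpa using ρ.comp_mem_left φ.inv hx)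
      exact ⟨J, fun e t ht => hJ ⟨t, ht, by simp⟩, hJ'⟩
    · obtain ⟨J, -, hJ⟩ := ρ.exists_complement (X := ob W) (Y := ob V) ⊥ bot_le
        fun x hx _ => (Submodule.mem_bot k).1 hx
      exact ⟨J, fun e' => absurd e' e, hJ⟩
  choose J h1 h2 h3 h4 using key
  refine ⟨⟨Unit, fun _ => r, fun _ => φ.hom, fun _ => φ.inv, by simp,
    fun i j h => absurd rfl h, by simp⟩, J, ⟨h2, h3, h4⟩, fun i j => ?_⟩
  simpa using h1 (dX.s i) r rfl _ (q_mem_scalarMapsTo dX i)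

theorem eqvGen_of_mem_layer (hs : IsSkeletal ob)
    {I : ℕ → ∀ W V : R, Submodule k (ob W ⟶ ob V)} (hI : ∀ l, Good ρ (I l)) {Z : C}
    (hZ : NoIdem Z) (m l : ℕ) (V : R) {x : Z ⟶ ob V} (hx : x ∈ layer ρ I Z m l V) (h0 : x ≠ 0) :
    Relation.EqvGen IrrStep Z (ob V) := by
  induction m generalizing l V with
  | zero =>
    by_cases hx1 : x ∈ ρ.pow 1 Z (ob V)
    · exact absurd (Submodule.disjoint_def.1 (layer_zero_isCompl (I := I) l V).disjoint x hx1 hx) h0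
    · have : IsIso x := by
        by_contra h
        exact hx1 (ρ.mem_one_of_not_isIso hZ (hs.noIdem V) h)
      exact .rel _ _ (Or.inr ⟨asIso x⟩)
  | succ m ih =>
    by_contra hc
    have h : layer ρ I Z (m + 1) l V ≤ ⊥ := by
      refine Submodule.span_le.2 ?_
      rintro _ ⟨W, y, φ, hy, hφ, rfl⟩
      by_contra hne
      have hy0 : y ≠ 0 := fun h => hne (by rw [h, Limits.zero_comp]; exact zero_mem _)
      have hφ0 : φ ≠ 0 := fun h => hne (by rw [h, Limits.comp_zero]; exact zero_mem _)
      refine hc ((ih _ _ hy hy0).trans _ _ _ (.rel _ _ (Or.inl ⟨hs.noIdem W, hs.noIdem V,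
        Or.inl ⟨φ, ρ.isIrr (hs.noIdem W) (hs.noIdem V) ((hI l).le _ _ hφ)
          fun h => hφ0 ((hI l).eq_zero _ _ _ hφ h)⟩⟩)))
    exact h0 ((Submodule.mem_bot k).1 (h hx))

theorem exists_annihilator_of_decomp [IsAlgClosed k] (hs : IsSkeletal ob)
    (hP : ∀ M : C, ∃ (S : NakayamaPair k C) (π : S.P ⟶ M), Epi π) {X Y Z : C} {f : X ⟶ Y}
    (hf : f ∈ ρ.pow 1 X Y) (dX : Decomp ob X) (dY : Decomp ob Y)
    {J : ∀ W V : R, Submodule k (ob W ⟶ ob V)} (hJ : Good ρ J)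
    (hfJ : ∀ i j, dX.q i ≫ f ≫ dY.p j ∈ J (dX.s i) (dY.s j)) {n : ℕ} {g : Z ⟶ X}
    (hg : g ∈ ρ.pow n Z X) (hg' : g ∉ ρ.pow (n + 1) Z X) (hgf : g ≫ f ∈ ρ.pow (n + 2) Z Y) :
    ∃ (W : C) (h : W ⟶ X) (i : dX.ι), NoIdem W ∧ Relation.EqvGen IrrStep W (ob (dX.s i)) ∧
      h ∈ ρ.pow n W X ∧ h ∉ ρ.pow (n + 1) W X ∧ h ≫ f = 0 := by
  obtain ⟨I, rfl, hI⟩ := exists_tower hs hP hJ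
  obtain ⟨dZ⟩ := Decomp.exists_decomp k hs.exists_iso Z
  obtain ⟨z, hz⟩ : ∃ z, dZ.q z ≫ g ∉ ρ.pow (n + 1) (ob (dZ.s z)) X := by
    by_contra! h
    refine hg' ?_
    rw [← Category.id_comp g, dZ.comp_eq_sum]
    exact Submodule.sum_mem _ fun a _ => ρ.comp_mem_right _ (h a)
  have h1 : ∀ i, ∃ y ∈ layer ρ I (ob (dZ.s z)) n 1 (dX.s i),
      dZ.q z ≫ g ≫ dX.p i - y ∈ ρ.pow (n + 1) _ _ := fun i => by
    obtain ⟨y, hy, w, hw, h⟩ := Submodule.mem_sup.1 (le_layer_sup hI n 1 (dX.s i)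
      (ρ.comp_mem_right (dZ.q z) (ρ.comp_mem_left (dX.p i) hg)))
    exact ⟨y, hy, by rwa [← h, add_sub_cancel_left]⟩
  choose y hy hyw using h1
  set h := ∑ i, y i ≫ dX.q i with hh
  have h2 : dZ.q z ≫ g - h ∈ ρ.pow (n + 1) _ _ := by
    have : dZ.q z ≫ g - h = ∑ i, (dZ.q z ≫ g ≫ dX.p i - y i) ≫ dX.q i := by
      rw [hh, ← Category.comp_id (dZ.q z ≫ g), dX.comp_eq_sum, ← Finset.sum_sub_distrib]
      simp [Preadditive.sub_comp]
    rw [this]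
    exact Submodule.sum_mem _ fun i _ => ρ.comp_mem_left _ (hyw i)
  have h3 : h ∉ ρ.pow (n + 1) _ _ := fun h' => hz (by simpa using Submodule.add_mem _ h2 h')
  have h4 : h ≫ f = 0 := dY.eq_zero_of_forall fun j => by
    refine eq_zero_of_mem_layer hs hI (n + 1) 0 _ (ρ := ρ) ?_ ?_
    · rw [hh, Category.assoc, Preadditive.sum_comp]
      refine Submodule.sum_mem _ fun i _ => ?_
      rw [Category.assoc]
      exact comp_mem_layer (hy i) (hfJ i j)
    · have : h ≫ f = dZ.q z ≫ g ≫ f - (dZ.q z ≫ g - h) ≫ f := by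
        simp [Preadditive.sub_comp]
      rw [this]
      exact ρ.comp_mem_left _ (Submodule.sub_mem _ (ρ.comp_mem_right _ hgf)
        (ρ.comp_mem (n + 1) 1 h2 hf))
  obtain ⟨i, hi⟩ : ∃ i, y i ≠ 0 := by
    by_contra! h0
    refine h3 ?_
    rw [hh, Finset.sum_eq_zero fun i _ => by rw [h0, Limits.zero_comp]]
    exact zero_mem _
  refine ⟨_, h, i, hs.noIdem _, eqvGen_of_mem_layer hs hI.good (hs.noIdem _) n 1 _ (hy i) hi,
    ?_, h3, h4⟩
  exact Submodule.sum_mem _ fun i _ => ρ.comp_mem_left _ (layer_le hI.good _ _ _ (hy i))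

theorem exists_annihilator_of_noIdem_source [IsAlgClosed k] (ρ : RadFiltration k C)
    (hP : ∀ M : C, ∃ (S : NakayamaPair k C) (π : S.P ⟶ M), Epi π) {X Y Z : C} {f : X ⟶ Y}
    (hX : NoIdem X) (hf : IsIrr f) {n : ℕ} {g : Z ⟶ X}
    (hg : g ∈ ρ.pow n Z X) (hg' : g ∉ ρ.pow (n + 1) Z X) (hgf : g ≫ f ∈ ρ.pow (n + 2) Z Y) :
    ∃ (W : C) (h : W ⟶ X), NoIdem W ∧ Relation.EqvGen IrrStep W X ∧
      h ∈ ρ.pow n W X ∧ h ∉ ρ.pow (n + 1) W X ∧ h ≫ f = 0 := by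
  obtain ⟨R, ob, hs⟩ := exists_isSkeletal C
  obtain ⟨dY⟩ := Decomp.exists_decomp k hs.exists_iso Y
  obtain ⟨dX, J, hJ, hfJ⟩ := hf.exists_good_source (ρ := ρ) hs hX hP dY
  obtain ⟨W, h, i, hW, hWX, hh⟩ := exists_annihilator_of_decomp hs hP
    (ρ.mem_one_of_not_isSplitMono hX hf.1) dX dY hJ hfJ hg hg' hgf
  have := hX.isIso_of_splitMono (hs.noIdem _).1 _ _ (dX.qp_self i)
  exact ⟨W, h, hW, hWX.trans _ _ _ (.rel _ _ (Or.inr ⟨asIso (dX.q i)⟩)), hh⟩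

theorem exists_annihilator_of_noIdem_target [IsAlgClosed k] (ρ : RadFiltration k C)
    (hP : ∀ M : C, ∃ (S : NakayamaPair k C) (π : S.P ⟶ M), Epi π) {X Y Z : C} {f : X ⟶ Y}
    (hY : NoIdem Y) (hf : IsIrr f) {n : ℕ} {g : Z ⟶ X}
    (hg : g ∈ ρ.pow n Z X) (hg' : g ∉ ρ.pow (n + 1) Z X) (hgf : g ≫ f ∈ ρ.pow (n + 2) Z Y) :
    ∃ (W : C) (h : W ⟶ X), NoIdem W ∧ Relation.EqvGen IrrStep W Y ∧
      h ∈ ρ.pow n W X ∧ h ∉ ρ.pow (n + 1) W X ∧ h ≫ f = 0 := by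
  obtain ⟨R, ob, hs⟩ := exists_isSkeletal C
  obtain ⟨dX⟩ := Decomp.exists_decomp k hs.exists_iso X
  obtain ⟨dY, J, hJ, hfJ⟩ := hf.exists_good_target (ρ := ρ) hs hY hP dX
  have hf1 := ρ.mem_one_of_not_isSplitEpi hY hf.2.1
  obtain ⟨W, h, i, hW, hWX, hh⟩ := exists_annihilator_of_decomp hs hP hf1 dX dY hJ hfJ hg hg' hgf
  refine ⟨W, h, hW, hWX.trans _ _ _ (.rel _ _ (Or.inl ⟨hs.noIdem _, hY,
    Or.inl ⟨dX.q i ≫ f, ρ.isIrr (hs.noIdem _) hY (ρ.comp_mem_right _ hf1) ?_⟩⟩)), hh⟩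
  exact hf.splitMono_comp_notMem hY (hs.noIdem _).1 hP (dX.qp_self i)

end Irreducible

section Opposite

open Opposite

variable {k : Type*} [Field k] {C : Type*} [Category C]

/-- The linear structure on the opposite of a linear category. -/
instance linearOpposite [Preadditive C] [Linear k C] : Linear k Cᵒᵖ where
  homModule X Y := Equiv.module k (opEquiv X Y)
  smul_comp X Y Z r f g :=
    Quiver.Hom.unop_inj (Linear.comp_smul Z.unop Y.unop X.unop g.unop r f.unop)
  comp_smul X Y Z f r g :=
    Quiver.Hom.unop_inj (Linear.smul_comp Z.unop Y.unop X.unop r g.unop f.unop)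

variable (k) in
/-- Passing to the opposite category is linear. -/
def opLinearEquiv [Preadditive C] [Linear k C] (X Y : C) : (X ⟶ Y) ≃ₗ[k] (op Y ⟶ op X) where
  toFun f := f.op
  invFun f := f.unop
  map_add' _ _ := rfl
  map_smul' _ _ := rfl
  left_inv _ := rfl
  right_inv _ := rfl

instance finiteDimensional_op [Preadditive C] [Linear k C] [∀ X Y : C, FiniteDimensional k (X ⟶ Y)]
    (X Y : Cᵒᵖ) : FiniteDimensional k (X ⟶ Y) :=
  (opLinearEquiv k Y.unop X.unop).finiteDimensional

theorem noIdem_op_iff [Preadditive C] {X : C} : NoIdem (op X) ↔ NoIdem X := by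
  refine and_congr ?_ ⟨fun h e he => ?_, fun h e he => ?_⟩
  · rw [not_iff_not]
    exact ⟨fun h => congrArg Quiver.Hom.unop h, fun h => congrArg Quiver.Hom.op h⟩
  · exact (h e.op (congrArg Quiver.Hom.op he)).imp (congrArg Quiver.Hom.unop)
      (congrArg Quiver.Hom.unop)
  · exact (h e.unop (congrArg Quiver.Hom.unop he)).imp (congrArg Quiver.Hom.op)
      (congrArg Quiver.Hom.op)

theorem isSplitMono_op_iff {X Y : C} (f : X ⟶ Y) : IsSplitMono f.op ↔ IsSplitEpi f :=
  ⟨fun ⟨⟨s, hs⟩⟩ => .mk' ⟨s.unop, congrArg Quiver.Hom.unop hs⟩,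
    fun ⟨⟨s, hs⟩⟩ => .mk' ⟨s.op, congrArg Quiver.Hom.op hs⟩⟩

theorem isSplitEpi_op_iff {X Y : C} (f : X ⟶ Y) : IsSplitEpi f.op ↔ IsSplitMono f :=
  ⟨fun ⟨⟨s, hs⟩⟩ => .mk' ⟨s.unop, congrArg Quiver.Hom.unop hs⟩,
    fun ⟨⟨s, hs⟩⟩ => .mk' ⟨s.op, congrArg Quiver.Hom.op hs⟩⟩

theorem isIrr_op_iff {X Y : C} (f : X ⟶ Y) : IsIrr f.op ↔ IsIrr f := by
  rw [IsIrr, IsIrr, isSplitMono_op_iff, isSplitEpi_op_iff]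
  constructor
  · rintro ⟨h1, h2, h3⟩
    refine ⟨h2, h1, fun Z g h hgh => ?_⟩
    rw [← isSplitMono_op_iff, ← isSplitEpi_op_iff]
    exact (h3 _ h.op g.op (congrArg Quiver.Hom.op hgh)).symm
  · rintro ⟨h1, h2, h3⟩
    refine ⟨h2, h1, fun Z g h hgh => ?_⟩
    have := h3 _ h.unop g.unop (congrArg Quiver.Hom.unop hgh)
    rw [← isSplitMono_op_iff, ← isSplitEpi_op_iff] at this
    exact this.symm

theorem IrrStep.unop [Preadditive C] {X Y : Cᵒᵖ} (h : IrrStep X Y) :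
    IrrStep X.unop Y.unop := by
  rcases h with ⟨hX, hY, h⟩ | ⟨⟨e⟩⟩
  · refine Or.inl ⟨noIdem_op_iff.1 hX, noIdem_op_iff.1 hY, ?_⟩
    rcases h with ⟨f, hf⟩ | ⟨f, hf⟩
    · exact Or.inr ⟨f.unop, (isIrr_op_iff _).1 hf⟩
    · exact Or.inl ⟨f.unop, (isIrr_op_iff _).1 hf⟩
  · exact Or.inr ⟨e.unop.symm⟩

theorem eqvGen_irrStep_unop [Preadditive C] {X Y : Cᵒᵖ} (h : Relation.EqvGen IrrStep X Y) :
    Relation.EqvGen IrrStep X.unop Y.unop := by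
  induction h with
  | rel _ _ h => exact .rel _ _ h.unop
  | refl => exact .refl _
  | symm _ _ _ ih => exact ih.symm
  | trans _ _ _ _ _ ih ih' => exact ih.trans _ _ _ ih'

/-- The radical filtration of the opposite category. -/
def RadFiltration.op [Preadditive C] [Linear k C] (ρ : RadFiltration k C) :
    RadFiltration k Cᵒᵖ where
  pow n X Y := (ρ.pow n Y.unop X.unop).map (opLinearEquiv k Y.unop X.unop).toLinearMap
  pow_zero X Y := by
    rw [ρ.pow_zero, Submodule.map_top]
    exact LinearEquiv.range _
  mem_one {X Y} f := by
    refine (Submodule.mem_map_equiv (ρ.pow 1 Y.unop X.unop) (x := f)).trans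
      ((ρ.mem_one f.unop).trans ⟨fun h g => ?_, fun h g => ?_⟩)
    · have := isIso_one_sub_swap _ _ (h g.unop)
      exact inferInstanceAs (IsIso (𝟙 X.unop - g.unop ≫ f.unop).op)
    · have := isIso_one_sub_swap _ _ (h g.op)
      exact inferInstanceAs (IsIso (𝟙 Y - g.op ≫ f).unop)
  comp_mem := by
    rintro X Y Z _ _ m n ⟨f, hf, rfl⟩ ⟨g, hg, rfl⟩
    exact ⟨g ≫ f, Nat.add_comm m n ▸ ρ.comp_mem n m hg hf, rfl⟩
  le_span m n X Z := by
    rw [Nat.add_comm m n]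
    refine (Submodule.map_mono (ρ.le_span n m Z.unop X.unop)).trans ?_
    rw [Submodule.map_span_le]
    rintro _ ⟨Y, f, g, hf, hg, rfl⟩
    exact Submodule.subset_span ⟨.op Y, g.op, f.op, ⟨g, hg, rfl⟩, ⟨f, hf, rfl⟩, rfl⟩

theorem RadFiltration.mem_op_iff [Preadditive C] [Linear k C] (ρ : RadFiltration k C) {n : ℕ}
    {X Y : C} {f : X ⟶ Y} :
    f.op ∈ ρ.op.pow n (Opposite.op Y) (Opposite.op X) ↔ f ∈ ρ.pow n X Y :=
  Submodule.mem_map_equiv (e := opLinearEquiv k X Y) _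

/-- The opposite of a Nakayama pair. -/
def NakayamaPair.op [Abelian C] [Linear k C] (S : NakayamaPair k C) : NakayamaPair k Cᵒᵖ where
  P := .op S.I
  I := .op S.P
  tr := S.tr ∘ₗ (opLinearEquiv k S.P S.I).symm.toLinearMap
  eq_zero_left M i h := Quiver.Hom.unop_inj (S.eq_zero_right M.unop i.unop fun x => h x.op)
  eq_zero_right M x h := Quiver.Hom.unop_inj (S.eq_zero_left M.unop x.unop fun i => h i.op)

end Opposite

section Radical

variable (k : Type) [Field k] {A : Type} [Ring A] [Algebra k A]

variable {k} in
theorem IsRadMor.comp_left {X Y Z : Mod A} {f : X ⟶ Y} (hf : IsRadMor f) (g : Y ⟶ Z) :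
    IsRadMor (f ≫ g) := fun h => by
  rw [Category.assoc]
  exact hf _

theorem IsRadMor.comp_right {X Y Z : Mod A} (f : X ⟶ Y) {g : Y ⟶ Z} (hg : IsRadMor g) :
    IsRadMor (f ≫ g) := fun h => by
  rw [Category.assoc]
  refine isIso_one_sub_swap _ _ ?_
  rw [Category.assoc]
  exact hg _

theorem IsRadMor.add {X Y : Mod A} {f f' : X ⟶ Y} (hf : IsRadMor f) (hf' : IsRadMor f') :
    IsRadMor (f + f') := fun g => by
  have h1 := hf g
  have h2 := hf' (g ≫ inv (𝟙 X - f ≫ g))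
  have h3 : 𝟙 X - (f + f') ≫ g =
      (𝟙 X - f' ≫ g ≫ inv (𝟙 X - f ≫ g)) ≫ (𝟙 X - f ≫ g) := by
    rw [Preadditive.sub_comp, Category.assoc, Category.assoc, IsIso.inv_hom_id,
      Preadditive.add_comp, Category.id_comp, Category.comp_id]
    abel
  rw [h3]
  infer_instance

/-- The radical morphisms form a subspace. -/
def radMor (X Y : Mod A) : Submodule k (X ⟶ Y) where
  carrier := {f | IsRadMor f}
  add_mem' := IsRadMor.add
  zero_mem' := fun g => by
    rw [Limits.zero_comp, sub_zero]
    infer_instance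
  smul_mem' := fun c f hf g => by
    rw [Linear.smul_comp, ← Linear.comp_smul]
    exact hf _

theorem RadComp.comp_right {X Y Z : Mod A} (f : X ⟶ Y) {n : ℕ} {g : Y ⟶ Z}
    (hg : RadComp n Y Z g) : RadComp n X Z (f ≫ g) := by
  cases hg with
  | zero => exact .zero _
  | succ h1 h2 h3 =>
    rw [← Category.assoc]
    exact .succ h1 (h2.comp_right f) h3

theorem RadComp.comp {X Y Z : Mod A} {f : X ⟶ Y} {m n : ℕ} {g : Y ⟶ Z}
    (hf : RadComp m X Y f) (hg : RadComp n Y Z g) : RadComp (m + n) X Z (f ≫ g) := by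
  induction hf with
  | zero f =>
    rw [Nat.zero_add]
    exact hg.comp_right f
  | succ h1 h2 _ ih =>
    rw [Nat.succ_add, Category.assoc]
    exact .succ h1 h2 (ih hg)

theorem RadComp.exists_comp {X Z : Mod A} {l : ℕ} {h : X ⟶ Z} (hh : RadComp l X Z h) (hX : FD X) :
    ∀ m n : ℕ, l = m + n → ∃ (Y : Mod A) (f : X ⟶ Y) (g : Y ⟶ Z), FD Y ∧ RadComp m X Y f ∧
      RadComp n Y Z g ∧ h = f ≫ g := by
  induction hh with
  | zero h =>
    intro m n hmn
    obtain ⟨rfl, rfl⟩ : m = 0 ∧ n = 0 := by lia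
    exact ⟨_, 𝟙 _, h, hX, .zero _, .zero _, (Category.id_comp _).symm⟩
  | @succ X Y Z l r g hY hr hg ih =>
    rintro (_ | m) n hmn
    · obtain rfl : n = l + 1 := by lia
      exact ⟨_, 𝟙 _, r ≫ g, hX, .zero _, .succ hY hr hg, (Category.id_comp _).symm⟩
    · obtain ⟨W, f, g', hW, hf, hg', rfl⟩ := ih hY m n (by lia)
      exact ⟨W, r ≫ f, g', hW, .succ hY hr hf, hg', (Category.assoc _ _ _).symm⟩

theorem radComp_one_iff {X Y : Mod A} (hY : FD Y) (f : X ⟶ Y) : RadComp 1 X Y f ↔ IsRadMor f := by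
  constructor
  · intro h
    cases h with
    | succ _ h _ => exact h.comp_left _
  · intro h
    rw [← Category.comp_id f]
    exact .succ hY h (.zero _)

theorem mem_radPow_one_iff {X Y : Mod A} (hY : FD Y) (f : X ⟶ Y) :
    f ∈ radPow k 1 X Y ↔ IsRadMor f := by
  refine ⟨fun h => ?_, fun h => Submodule.subset_span ((radComp_one_iff hY f).2 h)⟩
  exact (Submodule.span_le.2 fun g hg => (radComp_one_iff hY g).1 hg :
    radPow k 1 X Y ≤ radMor k X Y) h

variable {k} in
theorem comp_mem_radPow {X Y Z : Mod A} {f : X ⟶ Y} {g : Y ⟶ Z} (m n : ℕ)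
    (hf : f ∈ radPow k m X Y) (hg : g ∈ radPow k n Y Z) : f ≫ g ∈ radPow k (m + n) X Z := by
  refine Submodule.span_induction (p := fun f _ => f ≫ g ∈ radPow k (m + n) X Z) ?_ ?_ ?_ ?_ hf
  · intro f hf
    refine Submodule.span_induction (p := fun g _ => f ≫ g ∈ radPow k (m + n) X Z) ?_ ?_ ?_ ?_ hg
    · exact fun g hg => Submodule.subset_span (RadComp.comp hf hg)
    · rw [Limits.comp_zero]
      exact zero_mem _
    · intro _ _ _ _ h1 h2
      rw [Preadditive.comp_add]
      exact add_mem h1 h2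
    · intro c _ _ h
      rw [Linear.comp_smul]
      exact Submodule.smul_mem _ c h
  · rw [Limits.zero_comp]
    exact zero_mem _
  · intro _ _ _ _ h1 h2
    rw [Preadditive.add_comp]
    exact add_mem h1 h2
  · intro c _ _ h
    rw [Linear.smul_comp]
    exact Submodule.smul_mem _ c h

/-- Morphisms of finitely generated modules are morphisms of the underlying modules. -/
def homEquiv (X Y : FGModuleCat.{0} A) : (X ⟶ Y) ≃ₗ[k] (X.obj ⟶ Y.obj) where
  toFun f := f.hom
  invFun f := ObjectProperty.homMk f
  map_add' _ _ := rfl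
  map_smul' _ _ := rfl
  left_inv _ := rfl
  right_inv _ := rfl

theorem isIso_hom_iff {X Y : FGModuleCat.{0} A} (f : X ⟶ Y) : IsIso f.hom ↔ IsIso f :=
  isIso_iff_of_reflects_iso f (ModuleCat.isFG A).ι

variable (A) in
/-- The powers of the radical on the category of finitely generated modules. -/
def radFiltration [IsNoetherianRing A] : RadFiltration k (FGModuleCat.{0} A) where
  pow n X Y := (radPow k n X.obj Y.obj).comap (homEquiv k X Y).toLinearMap
  pow_zero X Y := by
    rw [eq_top_iff]
    exact fun f _ => Submodule.subset_span (RadComp.zero f.hom)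
  mem_one {X Y} f := by
    refine (mem_radPow_one_iff k Y.property f.hom).trans ⟨fun h g => ?_, fun h g => ?_⟩
    · exact (isIso_hom_iff _).1 (h g.hom)
    · exact (isIso_hom_iff _).2 (h (ObjectProperty.homMk g))
  comp_mem m n hf hg := comp_mem_radPow m n hf hg
  le_span m n X Z := by
    have : (radPow k (m + n) X.obj Z.obj) ≤ (Submodule.span k
      {h : X ⟶ Z | ∃ (Y : FGModuleCat.{0} A) (f : X ⟶ Y) (g : Y ⟶ Z),
        f.hom ∈ radPow k m X.obj Y.obj ∧ g.hom ∈ radPow k n Y.obj Z.obj ∧ h = f ≫ g}).map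
          (homEquiv k X Z).toLinearMap := by
      refine Submodule.span_le.2 fun h hh => ?_
      obtain ⟨Y, f, g, hY, hf, hg, rfl⟩ := RadComp.exists_comp hh X.property m n rfl
      exact ⟨_, Submodule.subset_span ⟨⟨Y, hY⟩, ObjectProperty.homMk f, ObjectProperty.homMk g,
        Submodule.subset_span hf, Submodule.subset_span hg, rfl⟩, rfl⟩
    intro h hh
    obtain ⟨h', hh', he⟩ := this hh
    obtain rfl := (homEquiv k X Z).injective he
    exact hh'

theorem noIdem_iff [IsNoetherianRing A] (X : FGModuleCat.{0} A) : NoIdem X ↔ Indec X.obj := by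
  refine and_congr ?_ ⟨fun h e he => ?_, fun h e he => ?_⟩
  · rw [Limits.IsZero.iff_id_eq_zero, not_iff_not]
    exact ⟨fun h => congrArg (fun t => t.hom) h, fun h => ObjectProperty.hom_ext _ h⟩
  · exact (h (ObjectProperty.homMk e) (ObjectProperty.hom_ext _ he)).imp
      (congrArg fun t : X ⟶ X => t.hom) (congrArg fun t : X ⟶ X => t.hom)
  · exact (h e.hom (congrArg (fun t => t.hom) he)).imp (fun h => ObjectProperty.hom_ext _ h)
      (fun h => ObjectProperty.hom_ext _ h)

theorem isSplitMono_hom_iff {X Y : FGModuleCat.{0} A} (f : X ⟶ Y) :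
    IsSplitMono f.hom ↔ IsSplitMono f :=
  ⟨fun ⟨⟨s, hs⟩⟩ => .mk' ⟨ObjectProperty.homMk s, ObjectProperty.hom_ext _ hs⟩,
    fun ⟨⟨s, hs⟩⟩ => .mk' ⟨s.hom, congrArg (fun t => t.hom) hs⟩⟩

theorem isSplitEpi_hom_iff {X Y : FGModuleCat.{0} A} (f : X ⟶ Y) :
    IsSplitEpi f.hom ↔ IsSplitEpi f :=
  ⟨fun ⟨⟨s, hs⟩⟩ => .mk' ⟨ObjectProperty.homMk s, ObjectProperty.hom_ext _ hs⟩,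
    fun ⟨⟨s, hs⟩⟩ => .mk' ⟨s.hom, congrArg (fun t => t.hom) hs⟩⟩

theorem isIrr_iff {X Y : FGModuleCat.{0} A} (f : X ⟶ Y) : IsIrr f ↔ Irred f.hom := by
  rw [IsIrr, Irred, isSplitMono_hom_iff, isSplitEpi_hom_iff]
  refine and_congr_right' (and_congr_right' ⟨fun h Z hZ g h' hg => ?_, fun h Z g h' hg => ?_⟩)
  · have := h ⟨Z, hZ⟩ (ObjectProperty.homMk g) (ObjectProperty.homMk h')
      (ObjectProperty.hom_ext _ hg)
    rwa [← isSplitMono_hom_iff, ← isSplitEpi_hom_iff] at this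
  · have := h Z.obj Z.property g.hom h'.hom (congrArg (fun t => t.hom) hg)
    rwa [isSplitMono_hom_iff, isSplitEpi_hom_iff] at this

theorem IrrStep.arStep [IsNoetherianRing A] {X Y : FGModuleCat.{0} A} (h : IrrStep X Y) :
    ARStep X.obj Y.obj := by
  rcases h with ⟨hX, hY, h⟩ | ⟨⟨e⟩⟩
  · refine Or.inl ⟨X.property, Y.property, (noIdem_iff X).1 hX, (noIdem_iff Y).1 hY, ?_⟩
    exact h.imp (fun ⟨f, hf⟩ => ⟨f.hom, (isIrr_iff f).1 hf⟩)
      (fun ⟨f, hf⟩ => ⟨f.hom, (isIrr_iff f).1 hf⟩)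
  · exact Or.inr ⟨(ModuleCat.isFG A).ι.mapIso e⟩

theorem sameComp_of_eqvGen [IsNoetherianRing A] {X Y : FGModuleCat.{0} A}
    (h : Relation.EqvGen IrrStep X Y) : SameComp X.obj Y.obj := by
  induction h with
  | rel _ _ h => exact .rel _ _ h.arStep
  | refl => exact .refl _
  | symm _ _ _ ih => exact ih.symm
  | trans _ _ _ _ _ ih ih' => exact ih.trans _ _ _ ih'

end Radical

section Cofree

variable (k : Type) [Field k] (A : Type) [Ring A] [Algebra k A]

/-- The dual of the free right module of rank `n`, as a left module. -/
def Cofree (n : ℕ) : Type := (Fin n → A) →ₗ[k] k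

namespace Cofree

variable {k A} {n : ℕ}

instance : AddCommGroup (Cofree k A n) := inferInstanceAs (AddCommGroup ((Fin n → A) →ₗ[k] k))

instance : Module k (Cofree k A n) := inferInstanceAs (Module k ((Fin n → A) →ₗ[k] k))

instance [FiniteDimensional k A] : FiniteDimensional k (Cofree k A n) :=
  inferInstanceAs (FiniteDimensional k ((Fin n → A) →ₗ[k] k))

/-- The value of an element of the dual. -/
def eval (φ : Cofree k A n) : (Fin n → A) →ₗ[k] k := φ

theorem zero_eval (q : Fin n → A) : (0 : Cofree k A n).eval q = 0 := rfl

theorem add_eval (φ ψ : Cofree k A n) (q : Fin n → A) : (φ + ψ).eval q = φ.eval q + ψ.eval q := rfl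

theorem smul_eval (c : k) (φ : Cofree k A n) (q : Fin n → A) : (c • φ).eval q = c * φ.eval q := rfl

theorem ext {φ ψ : Cofree k A n} (h : ∀ q, φ.eval q = ψ.eval q) : φ = ψ := LinearMap.ext h

instance : SMul A (Cofree k A n) :=
  ⟨fun a φ => φ.eval ∘ₗ LinearMap.pi fun i => LinearMap.mulRight k a ∘ₗ LinearMap.proj i⟩

theorem act_eval (a : A) (φ : Cofree k A n) (q : Fin n → A) :
    (a • φ).eval q = φ.eval fun i => q i * a := rfl

instance : Module A (Cofree k A n) where
  one_smul φ := ext fun q => by simp only [act_eval, mul_one]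
  mul_smul a b φ := ext fun q => by simp only [act_eval, mul_assoc]
  smul_zero a := rfl
  smul_add a φ ψ := rfl
  add_smul a b φ := ext fun q => by
    simp only [act_eval, add_eval, mul_add]
    exact map_add φ.eval _ _
  zero_smul φ := ext fun q => by
    simp only [act_eval, mul_zero]
    exact map_zero φ.eval

instance : IsScalarTower k A (Cofree k A n) :=
  ⟨fun c a φ => ext fun q => by
    simp only [act_eval, smul_eval, mul_smul_comm]
    exact map_smul φ.eval c _⟩

theorem algebraMap_eval (c : k) (φ : Cofree k A n) (q : Fin n → A) :
    (algebraMap k A c • φ).eval q = c * φ.eval q := by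
  rw [algebraMap_smul, smul_eval]

instance [FiniteDimensional k A] : Module.Finite A (Cofree k A n) :=
  Module.Finite.of_restrictScalars_finite k A _

variable {M : Type*} [AddCommGroup M] [Module A M]

/-- The linear form on maps from a free module to the corresponding dual. -/
def trace (t : (Fin n → A) →ₗ[A] Cofree k A n) : k :=
  ∑ j, (t (Pi.single j 1)).eval (Pi.single j 1)

theorem eq_zero_of_trace_left (i : M →ₗ[A] Cofree k A n)
    (h : ∀ x : (Fin n → A) →ₗ[A] M, trace (i ∘ₗ x) = 0) : i = 0 := by
  have h1 : ∀ m j, (i m).eval (Pi.single j 1) = 0 := fun m j => by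
    have := h (LinearMap.toSpanSingleton A M m ∘ₗ LinearMap.proj j)
    rw [trace, Finset.sum_eq_single j] at this
    · simpa using this
    · intro b _ hb
      simp [hb, zero_eval]
    · simp
  ext1 m
  refine ext fun q => ?_
  rw [← Finset.univ_sum_single q, map_sum]
  refine Finset.sum_eq_zero fun j _ => ?_
  have := h1 (q j • m) j
  rw [map_smul, act_eval] at this
  rw [← this]
  congr 1
  ext b
  by_cases hb : b = j
  · subst hb
    simp
  · simp [hb]

variable [Module k M] [IsScalarTower k A M]

/-- The element of the dual given by finitely many linear forms and an element of a module. -/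
def ofFormsFun (l : Fin n → M →ₗ[k] k) (m : M) : Cofree k A n :=
  (∑ j, l j ∘ₗ (LinearMap.toSpanSingleton A M m).restrictScalars k ∘ₗ LinearMap.proj j :
    (Fin n → A) →ₗ[k] k)

theorem ofFormsFun_eval (l : Fin n → M →ₗ[k] k) (m : M) (q : Fin n → A) :
    (ofFormsFun l m).eval q = ∑ j, l j (q j • m) :=
  (LinearMap.sum_apply _ _ q).trans (Finset.sum_congr rfl fun j _ => by simp)

/-- The module map into the dual of a free module given by finitely many linear forms. -/
def ofForms (l : Fin n → M →ₗ[k] k) : M →ₗ[A] Cofree k A n where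
  toFun := ofFormsFun l
  map_add' m m' := ext fun q => by
    simp [add_eval, ofFormsFun_eval, Finset.sum_add_distrib]
  map_smul' a m := ext fun q => by
    simp [act_eval, ofFormsFun_eval, mul_smul]

theorem ofForms_eval (l : Fin n → M →ₗ[k] k) (m : M) (q : Fin n → A) :
    (ofForms l m).eval q = ∑ j, l j (q j • m) :=
  ofFormsFun_eval l m q

theorem eq_zero_of_trace_right (x : (Fin n → A) →ₗ[A] M)
    (h : ∀ i : M →ₗ[A] Cofree k A n, trace (i ∘ₗ x) = 0) : x = 0 := by
  refine LinearMap.pi_ext' fun j => LinearMap.ext_ring ?_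
  refine (Module.forall_dual_apply_eq_zero_iff k _).1 fun l => ?_
  have := h (ofForms (Pi.single j l))
  rw [trace, Finset.sum_eq_single j] at this
  · rw [LinearMap.comp_apply, ofForms_eval, Finset.sum_eq_single j] at this
    · simpa using this
    · intro b _ hb
      simp [hb]
    · simp
  · intro b _ hb
    rw [LinearMap.comp_apply, ofForms_eval, Finset.sum_eq_single j]
    · simp [hb.symm]
    · intro c _ hc
      simp [hc]
    · simp
  · simp

theorem exists_injective [FiniteDimensional k M] :
    ∃ (n : ℕ) (i : M →ₗ[A] Cofree k A n), Function.Injective i := by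
  let b := Module.finBasis k M
  refine ⟨_, ofForms fun j => b.coord j, (injective_iff_map_eq_zero _).2 fun m hm => ?_⟩
  refine b.forall_coord_eq_zero_iff.1 fun j => ?_
  have := ofForms_eval (fun j => b.coord j) m (Pi.single j (1 : A))
  rw [hm, Finset.sum_eq_single j] at this
  · simpa [zero_eval] using this.symm
  · intro c _ hc
    simp [hc]
  · simp

end Cofree

open scoped ModuleCat

variable {k A}

theorem finite_of_isScalarTower [FiniteDimensional k A] (M : FGModuleCat.{0} A) :
    FiniteDimensional k M.obj :=
  Module.Finite.trans A M.obj

instance finiteDimensional_hom [FiniteDimensional k A] (X Y : FGModuleCat.{0} A) :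
    FiniteDimensional k (X ⟶ Y) := by
  have := finite_of_isScalarTower (k := k) X
  have := finite_of_isScalarTower (k := k) Y
  let F : (X ⟶ Y) →ₗ[k] (X.obj →ₗ[k] Y.obj) :=
    { toFun := fun f => f.hom.hom.restrictScalars k
      map_add' := fun _ _ => rfl
      map_smul' := fun _ _ => rfl }
  exact Module.Finite.of_injective F fun f g h =>
    FGModuleCat.hom_ext (LinearMap.ext fun x => LinearMap.congr_fun h x)

variable (k A) in
/-- The duality between the free module of rank `n` and the dual of the free right module. -/
noncomputable def nakayamaPair [FiniteDimensional k A] [IsNoetherianRing A] (n : ℕ) :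
    NakayamaPair k (FGModuleCat.{0} A) where
  P := FGModuleCat.of A (Fin n → A)
  I := FGModuleCat.of A (Cofree k A n)
  tr :=
    { toFun := fun t => Cofree.trace t.hom.hom
      map_add' := fun t t' => Finset.sum_add_distrib
      map_smul' := fun c t => by
        rw [RingHom.id_apply, smul_eq_mul, Cofree.trace, Cofree.trace, Finset.mul_sum]
        exact Finset.sum_congr rfl fun j _ => Cofree.algebraMap_eval c _ _ }
  eq_zero_left M i h := FGModuleCat.hom_ext
    (Cofree.eq_zero_of_trace_left i.hom.hom fun x => h (FGModuleCat.ofHom x))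
  eq_zero_right M x h := FGModuleCat.hom_ext
    (Cofree.eq_zero_of_trace_right x.hom.hom fun i => h (FGModuleCat.ofHom i))

variable (k) in
theorem exists_epi_nakayamaPair [FiniteDimensional k A] [IsNoetherianRing A]
    (M : FGModuleCat.{0} A) : ∃ (S : NakayamaPair k (FGModuleCat.{0} A)) (π : S.P ⟶ M), Epi π := by
  obtain ⟨n, f, hf⟩ := Module.Finite.exists_fin' A M.obj
  refine ⟨nakayamaPair k A n, FGModuleCat.ofHom f, (ModuleCat.isFG A).ι.epi_of_epi_map ?_⟩
  exact (ModuleCat.epi_iff_surjective _).2 hf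

variable (k) in
theorem exists_mono_nakayamaPair [FiniteDimensional k A] [IsNoetherianRing A]
    (M : FGModuleCat.{0} A) : ∃ (S : NakayamaPair k (FGModuleCat.{0} A)) (i : M ⟶ S.I), Mono i := by
  have := finite_of_isScalarTower (k := k) M
  obtain ⟨n, f, hf⟩ := Cofree.exists_injective (k := k) (A := A) (M := M.obj)
  refine ⟨nakayamaPair k A n, FGModuleCat.ofHom f, (ModuleCat.isFG A).ι.mono_of_mono_map ?_⟩
  exact (ModuleCat.mono_iff_injective _).2 hf

end Cofree

section Degree

variable {k : Type} [Field k] {A : Type} [Ring A] [Algebra k A] {X Y : Mod A} {f : X ⟶ Y} {n : ℕ}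

theorem leftDegBound_of_leftDeg_eq (h : leftDeg k f = (n : ℕ∞)) : LeftDegBound k f n := by
  have hne : {n : ℕ∞ | ∃ m : ℕ, n = (m : ℕ∞) ∧ LeftDegBound k f m}.Nonempty := by
    by_contra hc
    rw [Set.not_nonempty_iff_eq_empty] at hc
    rw [leftDeg, hc, sInf_empty] at h
    exact ENat.top_ne_natCast n h
  obtain ⟨m, hm, hb⟩ := csInf_mem hne
  rw [leftDeg, hm, Nat.cast_inj] at h
  exact h ▸ hb

theorem rightDegBound_of_rightDeg_eq (h : rightDeg k f = (n : ℕ∞)) : RightDegBound k f n := by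
  have hne : {n : ℕ∞ | ∃ m : ℕ, n = (m : ℕ∞) ∧ RightDegBound k f m}.Nonempty := by
    by_contra hc
    rw [Set.not_nonempty_iff_eq_empty] at hc
    rw [rightDeg, hc, sInf_empty] at h
    exact ENat.top_ne_natCast n h
  obtain ⟨m, hm, hb⟩ := csInf_mem hne
  rw [rightDeg, hm, Nat.cast_inj] at h
  exact h ▸ hb

theorem exists_annihilator_of_leftDegBound [IsAlgClosed k] [FiniteDimensional k A]
    (hX : FD X) (hY : FD Y) (hXi : Indec X) (hf : Irred f) (h : LeftDegBound k f n) :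
    ∃ Z : Mod A, FD Z ∧ Indec Z ∧ SameComp Z X ∧ ∃ h : Z ⟶ X,
      h ∈ radPow k n Z X ∧ h ∉ radPow k (n + 1) Z X ∧ h ≫ f = 0 := by
  have : IsNoetherianRing A := IsNoetherianRing.of_finite k A
  obtain ⟨-, Z, hZ, g, hg, hg', hgf⟩ := h
  obtain ⟨W, h, hW, hWX, hh, hh', hhf⟩ :=
    exists_annihilator_of_noIdem_source (radFiltration k A) (exists_epi_nakayamaPair k)
      (X := ⟨X, hX⟩) (Y := ⟨Y, hY⟩) (Z := ⟨Z, hZ⟩) (f := ObjectProperty.homMk f)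
      ((noIdem_iff _).2 hXi) ((isIrr_iff _).2 hf) (g := ObjectProperty.homMk g) hg hg' hgf
  exact ⟨W.obj, W.property, (noIdem_iff W).1 hW, sameComp_of_eqvGen hWX, h.hom, hh, hh',
    congrArg (fun t : W ⟶ ⟨Y, hY⟩ => t.hom) hhf⟩

theorem exists_annihilator_of_rightDegBound [IsAlgClosed k] [FiniteDimensional k A]
    (hX : FD X) (hY : FD Y) (hXi : Indec X) (hf : Irred f) (h : RightDegBound k f n) :
    ∃ Z : Mod A, FD Z ∧ Indec Z ∧ SameComp Z X ∧ ∃ h : Y ⟶ Z,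
      h ∈ radPow k n Y Z ∧ h ∉ radPow k (n + 1) Y Z ∧ f ≫ h = 0 := by
  have : IsNoetherianRing A := IsNoetherianRing.of_finite k A
  obtain ⟨-, Z, hZ, g, hg, hg', hgf⟩ := h
  let ρ := radFiltration k A
  let X' : FGModuleCat.{0} A := ⟨X, hX⟩
  let Y' : FGModuleCat.{0} A := ⟨Y, hY⟩
  let Z' : FGModuleCat.{0} A := ⟨Z, hZ⟩
  let f' : X' ⟶ Y' := ObjectProperty.homMk f
  let g' : Y' ⟶ Z' := ObjectProperty.homMk g
  have hP : ∀ M : (FGModuleCat.{0} A)ᵒᵖ,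
      ∃ (S : NakayamaPair k (FGModuleCat.{0} A)ᵒᵖ) (π : S.P ⟶ M), Epi π := fun M => by
    obtain ⟨S, i, hi⟩ := exists_mono_nakayamaPair k M.unop
    exact ⟨S.op, i.op, inferInstanceAs (Epi i.op)⟩
  obtain ⟨W, h, hW, hWX, hh, hh', hhf⟩ :=
    exists_annihilator_of_noIdem_target ρ.op hP (n := n) (f := f'.op) (g := g'.op)
      (noIdem_op_iff.2 ((noIdem_iff X').2 hXi)) ((isIrr_op_iff f').2 ((isIrr_iff f').2 hf))
      (ρ.mem_op_iff.2 hg) (fun h => hg' (ρ.mem_op_iff.1 h)) ((ρ.mem_op_iff (f := f' ≫ g')).2 hgf)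
  exact ⟨W.unop.obj, W.unop.property, (noIdem_iff W.unop).1 (noIdem_op_iff.1 hW),
    sameComp_of_eqvGen (eqvGen_irrStep_unop hWX), h.unop.hom, ρ.mem_op_iff.1 hh,
    fun h' => hh' (ρ.mem_op_iff.2 h'),
    congrArg (fun t : W ⟶ Opposite.op X' => t.unop.hom) hhf⟩

end Degree

end ARDegree

namespace ARDegree

open CategoryTheory

/-- **Proposition 3.1.** Let `f : X → Y` be irreducible with `X` indecomposable, `Γ` the
Auslander-Reiten component containing `X` and `n ∈ ℕ`. (a) If `d_l(f) = n` then there are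
`Z ∈ Γ` and `h ∈ rad^n(Z,X) ∖ rad^{n+1}(Z,X)` with `f ∘ h = 0`; (b) if `d_r(f) = n` then
there are `Z ∈ Γ` and `h ∈ rad^n(Y,Z) ∖ rad^{n+1}(Y,Z)` with `h ∘ f = 0`. -/
theorem degree_finite_exists_annihilating
    (k A : Type) [Field k] [IsAlgClosed k] [Ring A] [Algebra k A] [FiniteDimensional k A]
    (X Y : Mod A) (hX : FD X) (hY : FD Y) (hXi : Indec X)
    (f : X ⟶ Y) (hf : Irred f) (n : ℕ) :
    (leftDeg k f = (n : ℕ∞) →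
      ∃ Z : Mod A, FD Z ∧ Indec Z ∧ SameComp Z X ∧ ∃ h : Z ⟶ X,
        h ∈ radPow k n Z X ∧ h ∉ radPow k (n + 1) Z X ∧ h ≫ f = 0) ∧
    (rightDeg k f = (n : ℕ∞) →
      ∃ Z : Mod A, FD Z ∧ Indec Z ∧ SameComp Z X ∧ ∃ h : Y ⟶ Z,
        h ∈ radPow k n Y Z ∧ h ∉ radPow k (n + 1) Y Z ∧ f ≫ h = 0) :=
  ⟨fun h => exists_annihilator_of_leftDegBound hX hY hXi hf (leftDegBound_of_leftDeg_eq h),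
    fun h => exists_annihilator_of_rightDegBound hX hY hXi hf (rightDegBound_of_rightDeg_eq h)⟩

end ARDegree
end
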